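/- Let n ≥ 2, let 1 ≤ a < n, set t = gcd(2n, a), let K be a field, and let S = K[V(C_{2n}(a,n))]. (a) If 2n/t is even, then depth(S/I(C_{2n}(a,n))) = ⌈n/(2t)⌉ · t if n/t ≡ 1 (mod 4), and depth(S/I(C_{2n}(a,n))) = ⌈(n−t)/(2t)⌉ · t otherwise. (b) If 2n/t is odd, then depth(S/I(C_{2n}(a,n))) = ⌈(2n−t)/(2t)⌉ · (t/2) if 2n/t ≡ 1 (mod 4), and depth(S/I(C_{2n}(a,n))) = ⌈n/t⌉ · (t/2) if 2n/t ≡ 3 (mod 4). -/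

import Mathlib

open MvPolynomial

/-- The edge ideal of a simple graph `G`, inside `K[x_v : v ∈ V]`. -/
noncomputable def edgeIdeal (K : Type*) [Field K] {V : Type*} (G : SimpleGraph V) :
    Ideal (MvPolynomial V K) :=
  Ideal.span {m | ∃ i j : V, G.Adj i j ∧ m = X i * X j}

/-- The graded maximal ideal of `K[x_v : v ∈ V]`. -/
noncomputable def maxIdeal (K : Type*) [Field K] (V : Type*) : Ideal (MvPolynomial V K) :=
  Ideal.span (Set.range (X : V → MvPolynomial V K))

/-- depth of `S/I` over `S = K[x_v]`: the supremum of lengths of regular sequences on `S/I`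
consisting of elements of the graded maximal ideal. -/
noncomputable def depthQuot {K : Type*} [Field K] {V : Type*} (I : Ideal (MvPolynomial V K)) : ℕ :=
  sSup {n : ℕ | ∃ rs : List (MvPolynomial V K), rs.length = n ∧
    (∀ r ∈ rs, r ∈ maxIdeal K V) ∧
    RingTheory.Sequence.IsRegular (MvPolynomial V K ⧸ I) rs}

/-- The Stanley space `u·K[Z]` inside `S/I`, as a `K`-subspace. -/
noncomputable def stanleySpace {K : Type*} [Field K] {V : Type*}
    (I : Ideal (MvPolynomial V K)) (u : V →₀ ℕ) (Z : Finset V) :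
    Submodule K (MvPolynomial V K ⧸ I) :=
  Submodule.span K
    {x | ∃ a : V →₀ ℕ, a.support ⊆ Z ∧ x = Ideal.Quotient.mk I (monomial (u + a) (1 : K))}

/-- A Stanley decomposition of `S/I`: a finite family of Stanley spaces `u_j K[Z_j]`,
each of which is a free `K[Z_j]`-module (expressed by linear independence of the monomial
spanning set), whose internal direct sum is all of `S/I`. -/
structure StanleyDecomposition {K : Type*} [Field K] {V : Type*}
    (I : Ideal (MvPolynomial V K)) : Type _ where
  m : ℕ
  u : Fin m → (V →₀ ℕ)
  Z : Fin m → Finset V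
  free : ∀ j : Fin m, LinearIndependent K
    (fun a : {a : V →₀ ℕ // a.support ⊆ Z j} =>
      Ideal.Quotient.mk I (monomial (u j + (a : V →₀ ℕ)) (1 : K)))
  internal : DirectSum.IsInternal (fun j : Fin m => stanleySpace I (u j) (Z j))

/-- The Stanley depth of `S/I`. -/
noncomputable def sdepthQuot {K : Type*} [Field K] {V : Type*}
    (I : Ideal (MvPolynomial V K)) : ℕ :=
  sSup {n : ℕ | ∃ D : StanleyDecomposition I, ∀ j, n ≤ (D.Z j).card}

/-- `pdimLE R n M`: the `R`-module `M` has projective dimension at most `n`,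
i.e. it admits a projective resolution of length `n`. -/
def pdimLE (R : Type*) [CommRing R] :
    (n : ℕ) → (M : Type*) → [AddCommGroup M] → [Module R M] → Prop
  | 0, M, _, _ => Module.Projective R M
  | (n+1), M, _, _ => ∃ (P : Type _) (_ : AddCommGroup P) (_ : Module R P)
      (f : P →ₗ[R] M), Module.Projective R P ∧ Function.Surjective f ∧
        pdimLE R n (LinearMap.ker f)

/-- The projective dimension of `S/I` over `S`: the length of a minimal (projective/free)
resolution, i.e. the least `n` such that `S/I` has a projective resolution of length `n`. -/
noncomputable def pdimQuot {K : Type*} [Field K] {V : Type*}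
    (I : Ideal (MvPolynomial V K)) : ℕ :=
  sInf {n : ℕ | pdimLE (MvPolynomial V K) n (MvPolynomial V K ⧸ I)}

/-- The ladder graph `A n` on `2n` vertices: `inl i = x_{i+1}`, `inr i = y_{i+1}`. -/
def graphA (n : ℕ) : SimpleGraph (Fin n ⊕ Fin n) :=
  SimpleGraph.fromRel (fun a b =>
    match a, b with
    | .inl i, .inl j => (i : ℕ) + 1 = j
    | .inr i, .inr j => (i : ℕ) + 1 = j
    | .inl i, .inr j => (i : ℕ) = (j : ℕ)
    | .inr _, .inl _ => False)

/-- The graph `B n`: the ladder `A n` with one extra vertex `y_{n+1}` and edge `{y_n, y_{n+1}}`.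
Here `inl i = x_{i+1}` (`i < n`) and `inr i = y_{i+1}` (`i < n+1`). -/
def graphB (n : ℕ) : SimpleGraph (Fin n ⊕ Fin (n+1)) :=
  SimpleGraph.fromRel (fun a b =>
    match a, b with
    | .inl i, .inl j => (i : ℕ) + 1 = j
    | .inr i, .inr j => (i : ℕ) + 1 = j
    | .inl i, .inr j => (i : ℕ) = (j : ℕ)
    | .inr _, .inl _ => False)

/-- The graph `C n`: the ladder `A n` with two extra vertices `y_{n+1}, y_{n+2}` and extra
edges `{y_n, y_{n+1}}` and `{y_1, y_{n+2}}`. Here `inl i = x_{i+1}` (`i < n`) and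
`inr i = y_{i+1}` (`i < n+2`). -/
def graphC (n : ℕ) : SimpleGraph (Fin n ⊕ Fin (n+2)) :=
  SimpleGraph.fromRel (fun a b =>
    match a, b with
    | .inl i, .inl j => (i : ℕ) + 1 = j
    | .inr i, .inr j => ((i : ℕ) + 1 = j ∧ (j : ℕ) ≤ n) ∨ ((i : ℕ) = 0 ∧ (j : ℕ) = n + 1)
    | .inl i, .inr j => (i : ℕ) = (j : ℕ)
    | .inr _, .inl _ => False)

/-- The graph `D n`: the ladder `A n` with two extra vertices `x_{n+1}, y_{n+1}` and extra
edges `{y_n, y_{n+1}}` and `{x_1, x_{n+1}}`. Here `inl i = x_{i+1}` and `inr i = y_{i+1}`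
(`i < n+1`). -/
def graphD (n : ℕ) : SimpleGraph (Fin (n+1) ⊕ Fin (n+1)) :=
  SimpleGraph.fromRel (fun a b =>
    match a, b with
    | .inl i, .inl j => ((i : ℕ) + 1 = j ∧ (j : ℕ) ≤ n - 1) ∨ ((i : ℕ) = 0 ∧ (j : ℕ) = n)
    | .inr i, .inr j => (i : ℕ) + 1 = j
    | .inl i, .inr j => (i : ℕ) = (j : ℕ) ∧ (i : ℕ) ≤ n - 1
    | .inr _, .inl _ => False)

/-- The circulant graph `C_q(s)` on vertex set `{x_1, …, x_q}` (realized as `Fin q`):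
`x_i` and `x_j` are adjacent iff `|i - j| ∈ s` or `q - |i - j| ∈ s`. -/
def circulantGraph (q : ℕ) (s : Set ℕ) : SimpleGraph (Fin q) :=
  SimpleGraph.fromRel (fun i j =>
    ((i : ℤ) - (j : ℤ)).natAbs ∈ s ∨ q - ((i : ℤ) - (j : ℤ)).natAbs ∈ s)



open Classical in
/-- Abstract properties of the depth at least `n` predicate on vertex subsets. -/
structure DP {W : Type*} (G : SimpleGraph W) (Ω : Finset W) (D : Finset W → ℕ → Prop) : Prop where
  zero : ∀ U ⊆ Ω, D U 0
  mono : ∀ U ⊆ Ω, ∀ n, D U (n + 1) → D U n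
  empty : ¬ D ∅ 1
  iso : ∀ U ⊆ Ω, ∀ v ∈ U, (∀ w ∈ U, ¬ G.Adj v w) → ∀ n, (D U (n + 1) ↔ D (U.erase v) n)
  lower : ∀ U ⊆ Ω, ∀ P Q : Finset W, (∀ p ∈ P, ∀ q ∈ Q, G.Adj p q) → ∀ n,
    D (U \ P) (n + 1) → D (U \ Q) (n + 1) → D (U \ (P ∪ Q)) n → D U (n + 1)
  up1 : ∀ U ⊆ Ω, ∀ P Q : Finset W, (∀ p ∈ P, ∀ q ∈ Q, G.Adj p q) → ∀ n,
    D (U \ P) (n + 1) → D (U \ Q) (n + 1) → D U (n + 2) → D (U \ (P ∪ Q)) (n + 1)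
  up2 : ∀ U ⊆ Ω, ∀ P Q : Finset W, (∀ p ∈ P, ∀ q ∈ Q, G.Adj p q) → ∀ n,
    D U (n + 1) → D (U \ (P ∪ Q)) (n + 1) → D (U \ P) (n + 1)

/-- `U` has depth exactly `d`. -/
def IsD {W : Type*} (D : Finset W → ℕ → Prop) (U : Finset W) (d : ℕ) : Prop :=
  D U d ∧ ¬ D U (d + 1)

namespace DP

variable {W : Type*} {G : SimpleGraph W} {Ω : Finset W} {D : Finset W → ℕ → Prop}

lemma le (h : DP G Ω D) {U : Finset W} (hU : U ⊆ Ω) {m n : ℕ} (hmn : m ≤ n) (hn : D U n) :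
    D U m := by
  induction n, hmn using Nat.le_induction with
  | base => exact hn
  | succ n _ ih => exact ih (h.mono U hU n hn)

lemma isD_empty (h : DP G Ω D) : IsD D ∅ 0 := ⟨h.zero _ (Finset.empty_subset _), h.empty⟩

open Classical in
lemma iso_iff (h : DP G Ω D) {U C : Finset W} {v : W} (hU : U ⊆ Ω) (hv : v ∈ U)
    (hi : ∀ w ∈ U, ¬ G.Adj v w) (hC : ∀ w, w ∈ C ↔ w ∈ U ∧ w ≠ v) (n : ℕ) :
    D U (n + 1) ↔ D C n := by
  have : C = U.erase v := by ext w; rw [hC, Finset.mem_erase, and_comm]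
  rw [this]; exact h.iso U hU v hv hi n

lemma isD_iso (h : DP G Ω D) {U C : Finset W} {v : W} (hU : U ⊆ Ω) (hv : v ∈ U)
    (hi : ∀ w ∈ U, ¬ G.Adj v w) (hC : ∀ w, w ∈ C ↔ w ∈ U ∧ w ≠ v) {n : ℕ} (hd : IsD D C n) :
    IsD D U (n + 1) :=
  ⟨(h.iso_iff hU hv hi hC _).2 hd.1, fun h' => hd.2 ((h.iso_iff hU hv hi hC _).1 h')⟩

section vertex
variable {U A C : Finset W} {v : W}

open Classical in
lemma aux (h : DP G Ω D) (hU : U ⊆ Ω) (hv : v ∈ U)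
    (hC : ∀ w, w ∈ C ↔ w ∈ U ∧ w ≠ v) (hA : ∀ w, w ∈ A ↔ w ∈ U ∧ w ≠ v ∧ ¬ G.Adj v w) :
    (∀ p ∈ ({v} : Finset W), ∀ q ∈ U.filter (G.Adj v), G.Adj p q) ∧
    U \ {v} = C ∧ U \ ({v} ∪ U.filter (G.Adj v)) = A ∧
    ∀ n, (D (U \ U.filter (G.Adj v)) (n + 1) ↔ D A n) := by
  refine ⟨?_, ?_, ?_, ?_⟩
  · intro p hp q hq
    rw [Finset.mem_singleton] at hp; subst hp
    exact (Finset.mem_filter.1 hq).2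
  · ext w; simp [hC]
  · ext w; simp only [Finset.mem_sdiff, Finset.mem_union, Finset.mem_singleton, Finset.mem_filter, hA]
    tauto
  · intro n
    apply h.iso_iff (v := v) (Finset.sdiff_subset.trans hU)
    · simp [hv]
    · intro w hw; simp only [Finset.mem_sdiff, Finset.mem_filter] at hw; tauto
    · intro w; simp only [Finset.mem_sdiff, Finset.mem_filter, hA]; tauto

lemma vlow (h : DP G Ω D) (hU : U ⊆ Ω) (hv : v ∈ U)
    (hC : ∀ w, w ∈ C ↔ w ∈ U ∧ w ≠ v) (hA : ∀ w, w ∈ A ↔ w ∈ U ∧ w ≠ v ∧ ¬ G.Adj v w) {k : ℕ}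
    (h1 : D C (k + 1)) (h2 : D A k) : D U (k + 1) := by
  classical
  obtain ⟨a1, a2, a3, a4⟩ := h.aux hU hv hC hA
  exact h.lower U hU {v} _ a1 k (a2 ▸ h1) ((a4 k).2 h2) (a3 ▸ h2)

lemma vIs (h : DP G Ω D) (hU : U ⊆ Ω) (hv : v ∈ U)
    (hC : ∀ w, w ∈ C ↔ w ∈ U ∧ w ≠ v) (hA : ∀ w, w ∈ A ↔ w ∈ U ∧ w ≠ v ∧ ¬ G.Adj v w) {k : ℕ}
    (h1 : D C (k + 1)) (h2 : IsD D A k) : IsD D U (k + 1) := by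
  classical
  refine ⟨h.vlow hU hv hC hA h1 h2.1, fun h3 => h2.2 ?_⟩
  obtain ⟨a1, a2, a3, a4⟩ := h.aux hU hv hC hA
  have := h.up1 U hU {v} _ a1 k (a2 ▸ h1) ((a4 k).2 h2.1) h3
  rwa [a3] at this

lemma vup2 (h : DP G Ω D) (hU : U ⊆ Ω) (hv : v ∈ U)
    (hC : ∀ w, w ∈ C ↔ w ∈ U ∧ w ≠ v) (hA : ∀ w, w ∈ A ↔ w ∈ U ∧ w ≠ v ∧ ¬ G.Adj v w) {k : ℕ}
    (h1 : ¬ D C (k + 1)) (h2 : D A (k + 1)) : ¬ D U (k + 1) := by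
  classical
  obtain ⟨a1, a2, a3, a4⟩ := h.aux hU hv hC hA
  intro h3
  have := h.up2 U hU {v} _ a1 k h3 (a3 ▸ h2)
  rw [a2] at this
  exact h1 this

/-- `p` is a leaf with neighbour `v`. -/
lemma leaf (h : DP G Ω D) {p : W} (hU : U ⊆ Ω) (hv : v ∈ U) (hp : p ∈ U) (hpv : p ≠ v)
    (hl : ∀ w ∈ U, w ≠ v → ¬ G.Adj p w)
    (hC : ∀ w, w ∈ C ↔ w ∈ U ∧ w ≠ v ∧ w ≠ p)
    (hA : ∀ w, w ∈ A ↔ w ∈ U ∧ w ≠ v ∧ ¬ G.Adj v w) {k : ℕ}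
    (h1 : D C k) (h2 : IsD D A k) : IsD D U (k + 1) := by
  classical
  have hC' : ∀ w, w ∈ U.erase v ↔ w ∈ U ∧ w ≠ v := by
    intro w; rw [Finset.mem_erase, and_comm]
  refine h.vIs hU hv hC' hA ?_ h2
  refine (h.iso_iff (v := p) ((Finset.erase_subset _ _).trans hU) ?_ ?_ ?_ k).2 h1
  · simp [hpv, hp]
  · intro w hw; rw [hC'] at hw; exact hl w hw.1 hw.2
  · intro w; rw [hC, hC']; tauto

end vertex

lemma pairIs (h : DP G Ω D) {U A C1 C2 : Finset W} (P Q : Finset W) (hU : U ⊆ Ω)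
    (hPQ : ∀ p ∈ P, ∀ q ∈ Q, G.Adj p q)
    (hC1 : ∀ w, w ∈ C1 ↔ w ∈ U ∧ w ∉ P) (hC2 : ∀ w, w ∈ C2 ↔ w ∈ U ∧ w ∉ Q)
    (hA : ∀ w, w ∈ A ↔ w ∈ U ∧ w ∉ P ∧ w ∉ Q) {k : ℕ}
    (h1 : D C1 (k + 1)) (h2 : D C2 (k + 1)) (h3 : IsD D A k) : IsD D U (k + 1) := by
  classical
  have e1 : U \ P = C1 := by ext w; simp [hC1]
  have e2 : U \ Q = C2 := by ext w; simp [hC2]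
  have e3 : U \ (P ∪ Q) = A := by ext w; simp [hA]
  subst e1 e2 e3
  exact ⟨h.lower U hU P Q hPQ k h1 h2 h3.1, fun h4 => h3.2 (h.up1 U hU P Q hPQ k h1 h2 h4)⟩

lemma pairLow (h : DP G Ω D) {U A C1 C2 : Finset W} (P Q : Finset W) (hU : U ⊆ Ω)
    (hPQ : ∀ p ∈ P, ∀ q ∈ Q, G.Adj p q)
    (hC1 : ∀ w, w ∈ C1 ↔ w ∈ U ∧ w ∉ P) (hC2 : ∀ w, w ∈ C2 ↔ w ∈ U ∧ w ∉ Q)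
    (hA : ∀ w, w ∈ A ↔ w ∈ U ∧ w ∉ P ∧ w ∉ Q) {k : ℕ}
    (h1 : D C1 (k + 1)) (h2 : D C2 (k + 1)) (h3 : D A k) : D U (k + 1) := by
  classical
  have e1 : U \ P = C1 := by ext w; simp [hC1]
  have e2 : U \ Q = C2 := by ext w; simp [hC2]
  have e3 : U \ (P ∪ Q) = A := by ext w; simp [hA]
  subst e1 e2 e3
  exact h.lower U hU P Q hPQ k h1 h2 h3

lemma restrict (h : DP G Ω D) {G' : SimpleGraph W} {Ω' : Finset W} (hΩ : Ω' ⊆ Ω)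
    (hG : ∀ u ∈ Ω', ∀ v ∈ Ω', (G.Adj u v ↔ G'.Adj u v)) : DP G' Ω' D := by
  classical
  have key : ∀ U ⊆ Ω', ∀ P Q : Finset W, (∀ p ∈ P, ∀ q ∈ Q, G'.Adj p q) →
      (∀ p ∈ P ∩ U, ∀ q ∈ Q ∩ U, G.Adj p q) ∧ U \ P = U \ (P ∩ U) ∧ U \ Q = U \ (Q ∩ U) ∧
      U \ (P ∪ Q) = U \ (P ∩ U ∪ Q ∩ U) := by
    intro U hU P Q hPQ
    refine ⟨?_, ?_, ?_, ?_⟩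
    · intro p hp q hq
      rw [Finset.mem_inter] at hp hq
      exact (hG p (hU hp.2) q (hU hq.2)).2 (hPQ p hp.1 q hq.1)
    · ext w; simp
    · ext w; simp
    · ext w; simp only [Finset.mem_sdiff, Finset.mem_union, Finset.mem_inter]; tauto
  refine ⟨fun U hU => h.zero U (hU.trans hΩ), fun U hU => h.mono U (hU.trans hΩ), h.empty,
    ?_, ?_, ?_, ?_⟩
  · intro U hU v hv hi n
    convert h.iso U (hU.trans hΩ) v hv (fun w hw hvw => hi w hw ((hG v (hU hv) w (hU hw)).1 hvw)) n
  · intro U hU P Q hPQ n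
    obtain ⟨a, b, c, d⟩ := key U hU P Q hPQ
    intro h1 h2 h3
    apply h.lower U (hU.trans hΩ) _ _ a n
    · convert h1 using 1; convert b.symm
    · convert h2 using 1; convert c.symm
    · convert h3 using 1; convert d.symm
  · intro U hU P Q hPQ n
    obtain ⟨a, b, c, d⟩ := key U hU P Q hPQ
    intro h1 h2 h3
    have := h.up1 U (hU.trans hΩ) _ _ a n (by convert h1 using 1; convert b.symm)
      (by convert h2 using 1; convert c.symm) h3
    convert this using 1
  · intro U hU P Q hPQ n
    obtain ⟨a, b, c, d⟩ := key U hU P Q hPQ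
    intro h1 h2
    have := h.up2 U (hU.trans hΩ) _ _ a n h1 (by convert h2 using 1; convert d.symm)
    convert this using 1

open Classical in
lemma pullback (h : DP G Ω D) {W' : Type*} {G' : SimpleGraph W'} {Ω' : Finset W'} (s : W' → W)
    (hs : Set.InjOn s Ω') (hΩ : Ω'.image s ⊆ Ω)
    (hG : ∀ u ∈ Ω', ∀ v ∈ Ω', (G.Adj (s u) (s v) ↔ G'.Adj u v)) :
    DP G' Ω' (fun U => D (U.image s)) := by
  have sub : ∀ U ⊆ Ω', U.image s ⊆ Ω := fun U hU => (Finset.image_subset_image hU).trans hΩ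
  have key : ∀ U ⊆ Ω', ∀ P Q : Finset W', (∀ p ∈ P, ∀ q ∈ Q, G'.Adj p q) →
      (∀ p ∈ (P ∩ U).image s, ∀ q ∈ (Q ∩ U).image s, G.Adj p q) ∧
      U.image s \ (P ∩ U).image s = (U \ P).image s ∧
      U.image s \ (Q ∩ U).image s = (U \ Q).image s ∧
      U.image s \ ((P ∩ U).image s ∪ (Q ∩ U).image s) = (U \ (P ∪ Q)).image s := by
    intro U hU P Q hPQ
    have gen : ∀ P : Finset W', U.image s \ (P ∩ U).image s = (U \ P).image s := by
      intro P
      ext w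
      simp only [Finset.mem_sdiff, Finset.mem_image, Finset.mem_inter]
      constructor
      · rintro ⟨⟨x, hx, rfl⟩, h2⟩
        exact ⟨x, ⟨hx, fun hxP => h2 ⟨x, ⟨hxP, hx⟩, rfl⟩⟩, rfl⟩
      · rintro ⟨x, ⟨hx, hxP⟩, rfl⟩
        refine ⟨⟨x, hx, rfl⟩, ?_⟩
        rintro ⟨y, ⟨hyP, hy⟩, hxy⟩
        rw [hs (hU hy) (hU hx) hxy] at hyP
        exact hxP hyP
    refine ⟨?_, gen P, gen Q, ?_⟩
    · intro p hp q hq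
      rw [Finset.mem_image] at hp hq
      obtain ⟨p, hp, rfl⟩ := hp
      obtain ⟨q, hq, rfl⟩ := hq
      rw [Finset.mem_inter] at hp hq
      exact (hG p (hU hp.2) q (hU hq.2)).2 (hPQ p hp.1 q hq.1)
    · rw [← Finset.image_union, ← Finset.union_inter_distrib_right, gen]
  refine ⟨fun U hU => h.zero _ (sub U hU), fun U hU => h.mono _ (sub U hU), by simpa using h.empty,
    ?_, ?_, ?_, ?_⟩
  · intro U hU v hv hi n
    have e : (U.erase v).image s = (U.image s).erase (s v) := by
      ext w
      simp only [Finset.mem_erase, Finset.mem_image]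
      constructor
      · rintro ⟨x, ⟨hxv, hx⟩, rfl⟩
        exact ⟨fun h => hxv (hs (hU hx) (hU hv) h), x, hx, rfl⟩
      · rintro ⟨h1, x, hx, rfl⟩
        exact ⟨x, ⟨fun h => h1 (h ▸ rfl), hx⟩, rfl⟩
    show D _ _ ↔ D _ _
    rw [e]
    apply h.iso _ (sub U hU) _ (Finset.mem_image_of_mem s hv)
    intro w hw
    rw [Finset.mem_image] at hw
    obtain ⟨w, hw, rfl⟩ := hw
    rw [hG v (hU hv) w (hU hw)]
    exact hi w hw
  · intro U hU P Q hPQ n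
    obtain ⟨a, b, c, d⟩ := key U hU P Q hPQ
    intro h1 h2 h3
    exact h.lower _ (sub U hU) _ _ a n (b ▸ h1) (c ▸ h2) (d ▸ h3)
  · intro U hU P Q hPQ n
    obtain ⟨a, b, c, d⟩ := key U hU P Q hPQ
    intro h1 h2 h3
    exact d ▸ h.up1 _ (sub U hU) _ _ a n (b ▸ h1) (c ▸ h2) h3
  · intro U hU P Q hPQ n
    obtain ⟨a, b, c, d⟩ := key U hU P Q hPQ
    intro h1 h2
    exact b ▸ h.up2 _ (sub U hU) _ _ a n h1 (d ▸ h2)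

open Classical in
/-- Adding a separated part `R` of depth `c`. -/
lemma shift (h : DP G Ω D) {R Ω' : Finset W} {c : ℕ} (hR : IsD D R c) (hRΩ : R ⊆ Ω)
    (hΩ : Ω' ⊆ Ω) (hdis : Disjoint Ω' R) (hsep : ∀ u ∈ Ω', ∀ v ∈ R, ¬ G.Adj u v) :
    DP G Ω' (fun U n => D (U ∪ R) (n + c)) := by
  have sub : ∀ U ⊆ Ω', U ∪ R ⊆ Ω := fun U hU => Finset.union_subset (hU.trans hΩ) hRΩ
  have dj : ∀ {w}, w ∈ Ω' → w ∉ R := fun hw hr => Finset.disjoint_left.1 hdis hw hr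
  have key : ∀ U ⊆ Ω', ∀ P Q : Finset W, (∀ p ∈ P, ∀ q ∈ Q, G.Adj p q) →
      (∀ p ∈ P ∩ U, ∀ q ∈ Q ∩ U, G.Adj p q) ∧
      (U ∪ R) \ (P ∩ U) = (U \ P) ∪ R ∧ (U ∪ R) \ (Q ∩ U) = (U \ Q) ∪ R ∧
      (U ∪ R) \ (P ∩ U ∪ Q ∩ U) = (U \ (P ∪ Q)) ∪ R := by
    intro U hU P Q hPQ
    have gen : ∀ P : Finset W, (U ∪ R) \ (P ∩ U) = (U \ P) ∪ R := by
      intro P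
      ext w
      have := fun hw : w ∈ U => dj (hU hw)
      simp only [Finset.mem_sdiff, Finset.mem_union, Finset.mem_inter]
      tauto
    refine ⟨?_, gen P, gen Q, ?_⟩
    · intro p hp q hq
      rw [Finset.mem_inter] at hp hq
      exact hPQ p hp.1 q hq.1
    · rw [← Finset.union_inter_distrib_right, gen]
  have er : ∀ U ⊆ Ω', ∀ v ∈ U, U.erase v ∪ R = (U ∪ R).erase v := by
    intro U hU v hv
    ext w
    have := dj (hU hv)
    simp only [Finset.mem_erase, Finset.mem_union]
    constructor
    · rintro (h | h)
      · tauto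
      · exact ⟨fun e => this (e ▸ h), Or.inr h⟩
    · tauto
  have iso : ∀ U ⊆ Ω', ∀ v ∈ U, (∀ w ∈ U, ¬ G.Adj v w) → ∀ n,
      (D (U ∪ R) (n + 1) ↔ D (U.erase v ∪ R) n) := by
    intro U hU v hv hi n
    rw [er U hU v hv]
    apply h.iso _ (sub U hU) _ (Finset.mem_union_left _ hv)
    intro w hw
    rcases Finset.mem_union.1 hw with hw | hw
    · exact hi w hw
    · exact hsep v (hU hv) w hw
  have zero : ∀ U ⊆ Ω', D (U ∪ R) c := by
    intro U
    induction U using Finset.strongInduction with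
    | H U ih =>
      intro hU
      rcases U.eq_empty_or_nonempty with rfl | ⟨v, hv⟩
      · simpa using hR.1
      have h1 := ih (U.erase v) (Finset.erase_ssubset hv) ((Finset.erase_subset _ _).trans hU)
      by_cases hi : ∀ w ∈ U, ¬ G.Adj v w
      · exact h.mono _ (sub U hU) _ ((iso U hU v hv hi c).2 h1)
      · push Not at hi
        obtain ⟨w, hw, hvw⟩ := hi
        have hvR : ∀ x ∈ R, x ≠ v ∧ ¬ G.Adj v x :=
          fun x hx => ⟨fun e => dj (hU hv) (e ▸ hx), hsep v (hU hv) x hx⟩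
        have h2 := ih (U.filter (fun x => x ≠ v ∧ ¬ G.Adj v x))
          ⟨Finset.filter_subset _ _, fun hss => by simpa using hss hv⟩
          ((Finset.filter_subset _ _).trans hU)
        rcases c with _ | c
        · exact h.zero _ (sub U hU)
        · refine h.vlow (sub U hU) (Finset.mem_union_left _ hv) (C := U.erase v ∪ R)
            (A := U.filter (fun x => x ≠ v ∧ ¬ G.Adj v x) ∪ R) ?_ ?_ h1 (h.mono _ ?_ _ h2)
          · intro x; rw [er U hU v hv, Finset.mem_erase, and_comm]
          · intro x
            have := hvR x
            simp only [Finset.mem_union, Finset.mem_filter]; tauto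
          · exact sub _ ((Finset.filter_subset _ _).trans hU)
  refine ⟨?_, ?_, ?_, ?_, ?_, ?_, ?_⟩
  · intro U hU; simpa using zero U hU
  · intro U hU n hn
    exact h.mono _ (sub U hU) _ (by convert hn using 1; omega)
  · have := hR.2
    simpa [add_comm] using this
  · intro U hU v hv hi n
    show D _ _ ↔ D _ _
    rw [← iso U hU v hv hi, show n + 1 + c = n + c + 1 by omega]
  · intro U hU P Q hPQ n
    obtain ⟨a, b, c', d⟩ := key U hU P Q hPQ
    simp only [show n + 1 + c = n + c + 1 by omega]
    intro h1 h2 h3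
    exact h.lower _ (sub U hU) _ _ a _ (b ▸ h1) (c' ▸ h2) (d ▸ h3)
  · intro U hU P Q hPQ n
    obtain ⟨a, b, c', d⟩ := key U hU P Q hPQ
    simp only [show n + 1 + c = n + c + 1 by omega, show n + 2 + c = n + c + 2 by omega]
    intro h1 h2 h3
    exact d ▸ h.up1 _ (sub U hU) _ _ a _ (b ▸ h1) (c' ▸ h2) h3
  · intro U hU P Q hPQ n
    obtain ⟨a, b, c', d⟩ := key U hU P Q hPQ
    simp only [show n + 1 + c = n + c + 1 by omega]
    intro h1 h2
    exact b ▸ h.up2 _ (sub U hU) _ _ a _ h1 (d ▸ h2)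

open Classical in
lemma copies (h : DP G Ω D) (comp : ℕ → Finset W) (T d : ℕ) (hsub : ∀ r < T, comp r ⊆ Ω)
    (hdis : ∀ r < T, ∀ r' < T, r ≠ r' → Disjoint (comp r) (comp r'))
    (hsep : ∀ r < T, ∀ r' < T, r ≠ r' → ∀ u ∈ comp r, ∀ v ∈ comp r', ¬ G.Adj u v)
    (hd : ∀ r < T, ∀ D' : Finset W → ℕ → Prop, DP G (comp r) D' → IsD D' (comp r) d) :
    ∀ k ≤ T, IsD D ((Finset.range k).biUnion comp) (k * d) := by
  intro k hk
  induction k with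
  | zero => simpa using h.isD_empty
  | succ k ih =>
    have ih := ih (by omega)
    have := hd k (by omega) _ (h.shift ih (Ω' := comp k) ?_ (hsub k (by omega)) ?_ ?_)
    · rw [Finset.range_add_one, Finset.biUnion_insert]
      have e1 : (k + 1) * d = d + k * d := by ring
      rw [e1]
      refine ⟨this.1, ?_⟩
      have h2 : ¬ D _ (d + 1 + k * d) := this.2
      rwa [show d + 1 + k * d = d + k * d + 1 by ring] at h2
    · intro x hx
      simp only [Finset.mem_biUnion, Finset.mem_range] at hx
      obtain ⟨r, hr, hx⟩ := hx
      exact hsub r (by omega) hx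
    · rw [Finset.disjoint_biUnion_right]
      intro r hr
      rw [Finset.mem_range] at hr
      exact hdis k (by omega) r (by omega) (by omega)
    · intro u hu x hx
      simp only [Finset.mem_biUnion, Finset.mem_range] at hx
      obtain ⟨r, hr, hx⟩ := hx
      exact hsep k (by omega) r (by omega) (by omega) u hu x hx

end DP

/-! ### Ladders -/

/-- The infinite ladder. -/
def lad : SimpleGraph (ℕ × Bool) where
  Adj u v := (u.1 = v.1 ∧ u.2 ≠ v.2) ∨ (u.2 = v.2 ∧ (u.1 + 1 = v.1 ∨ v.1 + 1 = u.1))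
  symm := by
    constructor
    rintro u v h
    rcases h with ⟨h1, h2⟩ | ⟨h1, h2⟩
    · exact Or.inl ⟨h1.symm, h2.symm⟩
    · exact Or.inr ⟨h1.symm, h2.symm⟩
  loopless := ⟨fun u h => by
    rcases h with ⟨h1, h2⟩ | ⟨h1, h2⟩
    · exact h2 rfl
    · omega⟩

lemma lad_adj (i j : ℕ) (b c : Bool) :
    lad.Adj (i, b) (j, c) ↔ (i = j ∧ b ≠ c) ∨ (b = c ∧ (i + 1 = j ∨ j + 1 = i)) := Iff.rfl

/-- Full columns `o+1, …, o+n`. -/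
def stA (o n : ℕ) : Finset (ℕ × Bool) := Finset.Ioc o (o + n) ×ˢ Finset.univ

/-- Full columns `o+1, …, o+n`, the extra vertex `(o+n+1, b)`, and the extra set `L`. -/
def stE (L : Finset (ℕ × Bool)) (o n : ℕ) (b : Bool) : Finset (ℕ × Bool) :=
  L ∪ stA o n ∪ {(o + n + 1, b)}

lemma mem_stA (o n i : ℕ) (c : Bool) : (i, c) ∈ stA o n ↔ o < i ∧ i ≤ o + n := by
  simp [stA]

lemma mem_stE (L : Finset (ℕ × Bool)) (o n i : ℕ) (b c : Bool) :
    (i, c) ∈ stE L o n b ↔ (i, c) ∈ L ∨ (o < i ∧ i ≤ o + n) ∨ (i = o + n + 1 ∧ c = b) := by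
  simp only [stE, mem_stA, Finset.mem_union, Finset.mem_singleton, Prod.mk.injEq, or_assoc]

section ladder

variable {Ω : Finset (ℕ × Bool)} {D : Finset (ℕ × Bool) → ℕ → Prop}

/-- The recursion step for strips. -/
lemma stE_step (h : DP lad Ω D) (L : Finset (ℕ × Bool)) (o n : ℕ) (b : Bool)
    (hL : ∀ i c, (i, c) ∈ L → i ≤ o) (hU : stE L o (n + 2) b ⊆ Ω) {k : ℕ}
    (h1 : D (stE L o (n + 1) !b) k) (h2 : IsD D (stE L o n !b) k) :
    IsD D (stE L o (n + 2) b) (k + 1) := by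
  refine h.leaf (v := (o + n + 2, b)) (p := (o + n + 3, b)) hU ?_ ?_ ?_ ?_ ?_ ?_ h1 h2
  · rw [mem_stE]; omega
  · rw [mem_stE]; right; right; simp; omega
  · simp
  · rintro ⟨i, c⟩ hw hne
    have := hL i c
    rw [mem_stE] at hw; rw [lad_adj]
    by_cases hm : (i, c) ∈ L <;> cases b <;> cases c <;> simp [hm] at this hw hne ⊢ <;> omega
  · rintro ⟨i, c⟩
    have := hL i c
    rw [mem_stE, mem_stE]
    by_cases hm : (i, c) ∈ L <;> cases b <;> cases c <;> simp [hm] at this ⊢ <;> omega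
  · rintro ⟨i, c⟩
    have := hL i c
    rw [mem_stE, mem_stE, lad_adj]
    by_cases hm : (i, c) ∈ L <;> cases b <;> cases c <;> simp [hm] at this ⊢ <;> omega

lemma stE_sub (L : Finset (ℕ × Bool)) (o n : ℕ) (b b' : Bool) : stE L o n b ⊆ stE L o (n + 1) b' := by
  rintro ⟨i, c⟩; rw [mem_stE, mem_stE]
  rintro (h | h | h)
  · exact Or.inl h
  · right; left; omega
  · right; left; omega

lemma stB (h : DP lad Ω D) (o : ℕ) : ∀ n b, stE ∅ o n b ⊆ Ω → IsD D (stE ∅ o n b) (n / 2 + 1) := by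
  intro n
  induction n using Nat.strong_induction_on with
  | _ n ih =>
    intro b hU
    match n, ih, hU with
    | 0, _, hU =>
      refine h.isD_iso (v := (o + 1, b)) (C := ∅) hU ?_ ?_ ?_ h.isD_empty
      · simp [mem_stE]
      · rintro ⟨i, c⟩ hw; rw [mem_stE] at hw; rw [lad_adj]
        cases b <;> cases c <;> simp at hw ⊢ <;> omega
      · rintro ⟨i, c⟩; rw [mem_stE]; cases b <;> cases c <;> simp <;> omega
    | 1, _, hU =>
      have hC : stE ∅ o 0 (!b) ⊆ Ω := (stE_sub _ _ _ _ _).trans hU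
      refine h.leaf (v := (o + 1, b)) (p := (o + 2, b)) (A := ∅) (C := stE ∅ o 0 !b) hU ?_ ?_ ?_ ?_ ?_ ?_
        (h.zero _ hC) h.isD_empty
      · simp [mem_stE]
      · simp [mem_stE]
      · simp
      · rintro ⟨i, c⟩ hw hne
        rw [mem_stE] at hw; rw [lad_adj]
        cases b <;> cases c <;> simp at hw hne ⊢ <;> omega
      · rintro ⟨i, c⟩
        rw [mem_stE, mem_stE]
        cases b <;> cases c <;> simp <;> omega
      · rintro ⟨i, c⟩
        rw [mem_stE, lad_adj]
        cases b <;> cases c <;> simp <;> omega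
    | n + 2, ih, hU =>
      have s1 := (stE_sub ∅ o (n + 1) (!b) b).trans hU
      have s2 := (stE_sub ∅ o n (!b) (!b)).trans s1
      have h2 := ih n (by omega) (!b) s2
      have h1 := ih (n + 1) (by omega) (!b) s1
      have := stE_step h ∅ o n b (by simp) hU (h.le s1 (by omega) h1.1) h2
      rwa [show (n + 2) / 2 + 1 = n / 2 + 1 + 1 by omega]

lemma stA_isD (h : DP lad Ω D) (o : ℕ) : ∀ n, stA o n ⊆ Ω → IsD D (stA o n) ((n + 1) / 2) := by
  intro n
  induction n using Nat.strong_induction_on with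
  | _ n ih =>
    intro hU
    match n, ih, hU with
    | 0, _, hU =>
      have : stA o 0 = ∅ := by simp [stA]
      rw [this]; exact h.isD_empty
    | 1, _, hU =>
      refine h.leaf (v := (o + 1, true)) (p := (o + 1, false)) (A := ∅) (C := ∅) hU ?_ ?_ ?_ ?_ ?_ ?_
        (h.zero _ (by simp)) h.isD_empty
      · simp [mem_stA]
      · simp [mem_stA]
      · simp
      · rintro ⟨i, c⟩ hw hne
        rw [mem_stA] at hw; rw [lad_adj]
        cases c <;> simp at hw hne ⊢ <;> omega
      · rintro ⟨i, c⟩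
        rw [mem_stA]
        cases c <;> simp <;> omega
      · rintro ⟨i, c⟩
        rw [mem_stA, lad_adj]
        cases c <;> simp <;> omega
    | n + 2, ih, hU =>
      have s0 : stA o n ⊆ stA o (n + 2) := by
        rintro ⟨i, c⟩; rw [mem_stA, mem_stA]; omega
      have hB : ∀ b : Bool, stE ∅ o n b ∪ {(o + n + 2, !b)} ⊆ stA o (n + 2) := by
        rintro b ⟨i, c⟩; rw [Finset.mem_union, mem_stE, mem_stA]; simp; omega
      have hB2 : ∀ b : Bool, D (stE ∅ o n b ∪ {(o + n + 2, !b)}) ((n + 1) / 2 + 1) := by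
        intro b
        have s1 : stE ∅ o n b ⊆ Ω := Finset.subset_union_left.trans ((hB b).trans hU)
        refine (h.iso_iff (v := (o + n + 2, !b)) (C := stE ∅ o n b) ((hB b).trans hU) ?_ ?_ ?_ _).2
          (h.le s1 (by omega) (stB h o n b s1).1)
        · simp
        · rintro ⟨i, c⟩
          rw [Finset.mem_union, mem_stE, lad_adj]
          cases b <;> cases c <;> simp <;> omega
        · rintro ⟨i, c⟩
          rw [Finset.mem_union, mem_stE]
          cases b <;> cases c <;> simp <;> omega
      have := h.pairIs (U := stA o (n + 2)) {(o + n + 1, false), (o + n + 2, true)}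
        {(o + n + 1, true), (o + n + 2, false)} hU ?_ (C1 := stE ∅ o n true ∪ {(o + n + 2, !true)})
        (C2 := stE ∅ o n false ∪ {(o + n + 2, !false)}) (A := stA o n) ?_ ?_ ?_ (hB2 true) (hB2 false)
        (ih n (by omega) (s0.trans hU))
      · rwa [show (n + 2 + 1) / 2 = (n + 1) / 2 + 1 by omega]
      · intro p hp q hq
        simp only [Finset.mem_insert, Finset.mem_singleton] at hp hq
        rcases hp with rfl | rfl <;> rcases hq with rfl | rfl <;> rw [lad_adj] <;> simp
      · rintro ⟨i, c⟩
        rw [Finset.mem_union, mem_stE, mem_stA]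
        cases c <;> simp <;> omega
      · rintro ⟨i, c⟩
        rw [Finset.mem_union, mem_stE, mem_stA]
        cases c <;> simp <;> omega
      · rintro ⟨i, c⟩
        rw [mem_stA, mem_stA]
        cases c <;> simp <;> omega

/-- Strips with single vertices at both ends; `e = true` iff on the same side. -/
lemma stCD (h : DP lad Ω D) (o : ℕ) (c : Bool) : ∀ n b, stE {(o, c)} o n b ⊆ Ω →
    IsD D (stE {(o, c)} o n b) (if b = c then 2 * ((n + 2) / 4) + 1 else 2 * (n / 4) + 2) := by
  intro n
  induction n using Nat.strong_induction_on with
  | _ n ih =>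
    intro b hU
    match n, ih, hU with
    | 0, _, hU =>
      split_ifs with hb
      · subst hb
        refine h.leaf (v := (o, b)) (p := (o + 1, b)) (A := ∅) (C := ∅) hU ?_ ?_ ?_ ?_ ?_ ?_
          (h.zero _ (by simp)) h.isD_empty
        · simp [mem_stE]
        · simp [mem_stE]
        · simp
        · rintro ⟨i, c⟩ hw hne
          rw [mem_stE] at hw; rw [lad_adj]
          cases b <;> cases c <;> simp at hw hne ⊢ <;> omega
        · rintro ⟨i, c⟩
          rw [mem_stE]
          cases b <;> cases c <;> simp <;> omega
        · rintro ⟨i, c⟩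
          rw [mem_stE, lad_adj]
          cases b <;> cases c <;> simp <;> omega
      · have s1 : stE ∅ o 0 b ⊆ stE {(o, c)} o 0 b := by
          rintro ⟨i, c⟩; rw [mem_stE, mem_stE]; simp; tauto
        refine h.isD_iso (v := (o, c)) (C := stE ∅ o 0 b) hU ?_ ?_ ?_ (stB h o 0 b (s1.trans hU))
        · simp [mem_stE]
        · rintro ⟨i, c'⟩
          rw [mem_stE, lad_adj]
          cases b <;> cases c <;> cases c' <;> simp at hb ⊢ <;> omega
        · rintro ⟨i, c'⟩
          rw [mem_stE, mem_stE]
          cases b <;> cases c <;> cases c' <;> simp at hb ⊢ <;> omega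
    | 1, ih, hU =>
      have s1 := (stE_sub {(o, c)} o 0 (!b) b).trans hU
      have h0 := ih 0 (by omega) (!b) s1
      split_ifs with hb
      · subst hb
        refine h.leaf (v := (o + 1, b)) (p := (o + 2, b)) (A := ∅) (C := stE {(o, b)} o 0 !b) hU
          ?_ ?_ ?_ ?_ ?_ ?_ (h.zero _ s1) h.isD_empty
        · simp [mem_stE]
        · simp [mem_stE]
        · simp
        · rintro ⟨i, c⟩ hw hne
          rw [mem_stE] at hw; rw [lad_adj]
          cases b <;> cases c <;> simp at hw hne ⊢ <;> omega
        · rintro ⟨i, c⟩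
          rw [mem_stE, mem_stE]
          cases b <;> cases c <;> simp <;> omega
        · rintro ⟨i, c⟩
          rw [mem_stE, lad_adj]
          cases b <;> cases c <;> simp <;> omega
      · have hbc : c = !b := by cases b <;> cases c <;> simp_all
        subst hbc
        simp only [if_true] at h0
        have hsing : IsD D {(o, !b)} 1 := by
          refine h.isD_iso (v := (o, !b)) (C := ∅) ?_ ?_ ?_ ?_ h.isD_empty
          · rintro ⟨i, c⟩ hx; apply hU; rw [mem_stE]; exact Or.inl hx
          · simp
          · rintro ⟨i, c⟩ hw; rw [lad_adj]; cases b <;> cases c <;> simp at hw ⊢ <;> omega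
          · simp
        refine h.leaf (v := (o + 1, b)) (p := (o + 2, b)) (A := {(o, !b)})
          (C := stE {(o, !b)} o 0 !b) hU ?_ ?_ ?_ ?_ ?_ ?_ h0.1 hsing
        · simp [mem_stE]
        · simp [mem_stE]
        · simp
        · rintro ⟨i, c⟩ hw hne
          rw [mem_stE] at hw; rw [lad_adj]
          cases b <;> cases c <;> simp at hw hne ⊢ <;> omega
        · rintro ⟨i, c⟩
          rw [mem_stE, mem_stE]
          cases b <;> cases c <;> simp <;> omega
        · rintro ⟨i, c⟩
          rw [mem_stE, lad_adj]
          cases b <;> cases c <;> simp <;> omega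
    | n + 2, ih, hU =>
      have s1 := (stE_sub {(o, c)} o (n + 1) (!b) b).trans hU
      have s2 := (stE_sub {(o, c)} o n (!b) (!b)).trans s1
      have h2 := ih n (by omega) (!b) s2
      have h1 := ih (n + 1) (by omega) (!b) s1
      have := stE_step h {(o, c)} o n b (by simp) hU
        (h.le s1 (by split_ifs <;> omega) h1.1) h2
      convert this using 1
      cases b <;> cases c <;> simp <;> omega

end ladder

/-! ### Cyclic ladders -/

/-- Wrap-around adjacency. -/
def wrapRel (m : ℕ) (τ : Bool) (u v : ℕ × Bool) : Prop :=
  u.1 = 0 ∧ v.1 + 1 = m ∧ v.2 = xor u.2 τ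

/-- The prism (`τ = false`) or Möbius ladder (`τ = true`) with `m` rungs. -/
def cyc (m : ℕ) (τ : Bool) : SimpleGraph (ℕ × Bool) where
  Adj u v := u ≠ v ∧ (lad.Adj u v ∨ wrapRel m τ u v ∨ wrapRel m τ v u)
  symm := ⟨fun u v h => ⟨h.1.symm, by have := h.2; rw [lad.adj_comm] at this; tauto⟩⟩
  loopless := ⟨fun u h => h.1 rfl⟩

lemma cyc_adj (m i j : ℕ) (τ b c : Bool) : (cyc m τ).Adj (i, b) (j, c) ↔
    (i, b) ≠ (j, c) ∧ (((i = j ∧ b ≠ c) ∨ (b = c ∧ (i + 1 = j ∨ j + 1 = i))) ∨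
      (i = 0 ∧ j + 1 = m ∧ c = xor b τ) ∨ (j = 0 ∧ i + 1 = m ∧ b = xor c τ)) := Iff.rfl

/-- All vertices of the cyclic ladder. -/
def cycΩ (m : ℕ) : Finset (ℕ × Bool) := Finset.range m ×ˢ Finset.univ

lemma mem_cycΩ (m i : ℕ) (c : Bool) : (i, c) ∈ cycΩ m ↔ i < m := by simp [cycΩ]

section cyclic

variable {τ : Bool} {D : Finset (ℕ × Bool) → ℕ → Prop}

/-- value of strips occurring in cyclic ladders -/
def cdVal (same : Bool) (n : ℕ) : ℕ := if same then 2 * ((n + 2) / 4) + 1 else 2 * (n / 4) + 2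

lemma cyc_A {m : ℕ} (h : DP (cyc m τ) (cycΩ m) D) (n : ℕ) (hn : n + 1 ≤ m) :
    IsD D (stA 0 n) ((n + 1) / 2) := by
  refine stA_isD (Ω := stA 0 n) (h.restrict ?_ ?_) 0 n subset_rfl
  · rintro ⟨i, c⟩; rw [mem_stA, mem_cycΩ]; omega
  · rintro ⟨i, b⟩ hu ⟨j, c⟩ hv
    rw [mem_stA] at hu hv
    rw [cyc_adj, lad_adj]
    cases b <;> cases c <;> simp <;> omega

lemma cyc_E {n : ℕ} (h : DP (cyc (n + 2) τ) (cycΩ (n + 2)) D) (b : Bool) :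
    IsD D (stE {(0, !b)} 0 n (xor b τ)) (cdVal τ n) := by
  have := stCD (D := D) (Ω := stE {(0, !b)} 0 n (xor b τ)) (h.restrict ?_ ?_) 0 (!b) n (xor b τ) subset_rfl
  · convert this using 1
    unfold cdVal
    cases b <;> cases τ <;> simp
  · rintro ⟨i, c⟩; rw [mem_stE, mem_cycΩ]; simp; omega
  · rintro ⟨i, b'⟩ hu ⟨j, c⟩ hv
    rw [mem_stE] at hu hv
    rw [cyc_adj, lad_adj]
    cases b <;> cases τ <;> cases b' <;> cases c <;> simp at hu hv ⊢ <;> omega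

lemma cyc_E1 {n : ℕ} (h : DP (cyc (n + 3) τ) (cycΩ (n + 3)) D) (b : Bool) :
    IsD D (stE {(1, b)} 1 n (xor b τ)) (cdVal (!τ) n) := by
  have := stCD (D := D) (Ω := stE {(1, b)} 1 n (xor b τ)) (h.restrict ?_ ?_) 1 b n (xor b τ) subset_rfl
  · convert this using 1
    unfold cdVal
    cases b <;> cases τ <;> simp
  · rintro ⟨i, c⟩; rw [mem_stE, mem_cycΩ]; simp; omega
  · rintro ⟨i, b'⟩ hu ⟨j, c⟩ hv
    rw [mem_stE] at hu hv
    rw [cyc_adj, lad_adj]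
    cases b <;> cases τ <;> cases b' <;> cases c <;> simp at hu hv ⊢ <;> omega

lemma cyc_pair_aux {n : ℕ} (τ : Bool) :
    (∀ p ∈ ({(0, true), (n + 1, !(xor true τ))} : Finset (ℕ × Bool)),
      ∀ q ∈ ({(0, false), (n + 1, xor true τ)} : Finset (ℕ × Bool)), (cyc (n + 2) τ).Adj p q) ∧
    (∀ w, w ∈ stE {(0, !true)} 0 n (xor true τ) ↔ w ∈ cycΩ (n + 2) ∧
      w ∉ ({(0, true), (n + 1, !(xor true τ))} : Finset (ℕ × Bool))) ∧
    (∀ w, w ∈ stE {(0, !false)} 0 n (xor false τ) ↔ w ∈ cycΩ (n + 2) ∧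
      w ∉ ({(0, false), (n + 1, xor true τ)} : Finset (ℕ × Bool))) ∧
    (∀ w, w ∈ stA 0 n ↔ w ∈ cycΩ (n + 2) ∧
      w ∉ ({(0, true), (n + 1, !(xor true τ))} : Finset (ℕ × Bool)) ∧
      w ∉ ({(0, false), (n + 1, xor true τ)} : Finset (ℕ × Bool))) := by
  refine ⟨?_, ?_, ?_, ?_⟩
  · intro p hp q hq
    simp only [Finset.mem_insert, Finset.mem_singleton] at hp hq
    rcases hp with rfl | rfl <;> rcases hq with rfl | rfl <;> rw [cyc_adj] <;> cases τ <;> simp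
  · rintro ⟨i, c⟩
    rw [mem_stE, mem_cycΩ]
    cases τ <;> cases c <;> simp <;> omega
  · rintro ⟨i, c⟩
    rw [mem_stE, mem_cycΩ]
    cases τ <;> cases c <;> simp <;> omega
  · rintro ⟨i, c⟩
    rw [mem_stA, mem_cycΩ]
    cases τ <;> cases c <;> simp <;> omega

lemma sub_cycΩ {m : ℕ} {U V : Finset (ℕ × Bool)} {p : ℕ × Bool → Prop} (hV : V ⊆ cycΩ m)
    (h : ∀ w, w ∈ U ↔ w ∈ V ∧ p w) : U ⊆ cycΩ m := fun w hw => hV ((h w).1 hw).1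

lemma cyc_low {n : ℕ} (h : DP (cyc (n + 2) τ) (cycΩ (n + 2)) D) (k : ℕ)
    (h1 : k + 1 ≤ cdVal τ n) (h2 : k ≤ (n + 1) / 2) : D (cycΩ (n + 2)) (k + 1) := by
  obtain ⟨a1, a2, a3, a4⟩ := cyc_pair_aux (n := n) τ
  exact h.pairLow _ _ subset_rfl a1 a2 a3 a4 (h.le (sub_cycΩ subset_rfl a2) h1 (cyc_E h true).1)
    (h.le (sub_cycΩ subset_rfl a3) h1 (cyc_E h false).1)
    (h.le (sub_cycΩ subset_rfl a4) h2 (cyc_A h n (by omega)).1)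

lemma cyc_pair {n : ℕ} (h : DP (cyc (n + 2) τ) (cycΩ (n + 2)) D)
    (h1 : (n + 1) / 2 + 1 ≤ cdVal τ n) : IsD D (cycΩ (n + 2)) ((n + 1) / 2 + 1) := by
  obtain ⟨a1, a2, a3, a4⟩ := cyc_pair_aux (n := n) τ
  exact h.pairIs _ _ subset_rfl a1 a2 a3 a4 (h.le (sub_cycΩ subset_rfl a2) h1 (cyc_E h true).1)
    (h.le (sub_cycΩ subset_rfl a3) h1 (cyc_E h false).1) (cyc_A h n (by omega))

lemma cyc_up {n : ℕ} (h : DP (cyc (n + 3) τ) (cycΩ (n + 3)) D)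
    (h1 : (n + 3) / 2 + 1 ≤ cdVal (!τ) n) : ¬ D (cycΩ (n + 3)) ((n + 3) / 2 + 1) := by
  classical
  have hE : ∀ b, D (stE {(1, b)} 1 n (xor b τ)) ((n + 3) / 2 + 1) := by
    intro b
    refine h.le ?_ h1 (cyc_E1 h b).1
    rintro ⟨i, c⟩; rw [mem_stE, mem_cycΩ]; simp; omega
  have hF : ¬ D ((cycΩ (n + 3)).erase (0, true)) ((n + 3) / 2 + 1) := by
    refine h.vup2 (v := (0, false)) (C := stA 0 (n + 2)) (A := stE {(1, true)} 1 n (xor true τ))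
      (Finset.erase_subset _ _) ?_ ?_ ?_ (cyc_A h (n + 2) (by omega)).2 (hE true)
    · simp [mem_cycΩ]
    · rintro ⟨i, c⟩
      rw [mem_stA, Finset.mem_erase, mem_cycΩ]
      cases c <;> simp <;> omega
    · rintro ⟨i, c⟩
      rw [mem_stE, Finset.mem_erase, mem_cycΩ, cyc_adj]
      cases τ <;> cases c <;> simp <;> omega
  refine h.vup2 (v := (0, true)) (C := (cycΩ (n + 3)).erase (0, true))
    (A := stE {(1, false)} 1 n (xor false τ)) subset_rfl ?_ ?_ ?_ hF (hE false)
  · simp [mem_cycΩ]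
  · intro w; rw [Finset.mem_erase, and_comm]
  · rintro ⟨i, c⟩
    rw [mem_stE, mem_cycΩ, cyc_adj]
    cases τ <;> cases c <;> simp <;> omega

lemma cyc_moebius {m : ℕ} (hm : 2 ≤ m) (h : DP (cyc m true) (cycΩ m) D) :
    IsD D (cycΩ m) (if m % 4 = 1 then (m + 1) / 2 else m / 2) := by
  obtain ⟨n, rfl⟩ : ∃ n, m = n + 2 := ⟨m - 2, by omega⟩
  by_cases h3 : (n + 2) % 4 = 3
  · rw [if_neg (by omega)]
    obtain ⟨l, rfl⟩ : ∃ l, n = l + 1 := ⟨n - 1, by omega⟩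
    refine ⟨?_, cyc_up h ?_⟩
    · have := cyc_low h ((l + 1) / 2) (by unfold cdVal; simp; omega) (by omega)
      rwa [show (l + 1 + 2) / 2 = (l + 1) / 2 + 1 by omega]
    · unfold cdVal; simp; omega
  · have := cyc_pair h (by unfold cdVal; simp; omega)
    convert this using 1
    split_ifs <;> omega

lemma cyc_prism {m : ℕ} (hm : 3 ≤ m) (ho : m % 2 = 1) (h : DP (cyc m false) (cycΩ m) D) :
    IsD D (cycΩ m) (if m % 4 = 1 then (m - 1) / 2 else (m + 1) / 2) := by
  obtain ⟨l, rfl⟩ : ∃ l, m = l + 3 := ⟨m - 3, by omega⟩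
  by_cases h3 : (l + 3) % 4 = 1
  · rw [if_pos h3]
    rw [show (l + 3 - 1) / 2 = (l + 3) / 2 by omega]
    refine ⟨?_, cyc_up h ?_⟩
    · have := cyc_low (n := l + 1) h ((l + 1) / 2) (by unfold cdVal; simp; omega) (by omega)
      rwa [show (l + 3) / 2 = (l + 1) / 2 + 1 by omega]
    · unfold cdVal; simp; omega
  · rw [if_neg h3]
    have := cyc_pair (n := l + 1) h (by unfold cdVal; simp; omega)
    convert this using 1
    omega

end cyclic

/-! ### The circulant graph as a disjoint union of cyclic ladders -/

section circ

lemma circ_adj {n a : ℕ} (ha1 : 1 ≤ a) (han : a < n) (u v : Fin (2 * n)) :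
    (circulantGraph (2 * n) ({a, n} : Set ℕ)).Adj u v ↔
      (v.val = (u.val + a) % (2 * n) ∨ u.val = (v.val + a) % (2 * n) ∨
        v.val = (u.val + n) % (2 * n)) := by
  have hmod : ∀ x, x < 4 * n → x % (2 * n) = if x < 2 * n then x else x - 2 * n := by
    intro x hx
    split_ifs with h
    · exact Nat.mod_eq_of_lt h
    · rw [Nat.mod_eq_sub_mod (by omega), Nat.mod_eq_of_lt (by omega)]
  have hu := u.2
  have hv := v.2
  rw [hmod _ (by omega), hmod _ (by omega), hmod _ (by omega)]
  simp only [circulantGraph, SimpleGraph.fromRel_adj, Set.mem_insert_iff, Set.mem_singleton_iff,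
    ne_eq, Fin.ext_iff]
  split_ifs <;> omega

/-- The parametrization of the component through `r`. -/
def cmap (n a : ℕ) (hn : 0 < 2 * n) (r : ℕ) (p : ℕ × Bool) : Fin (2 * n) :=
  ⟨(r + p.1 * a + (if p.2 then n else 0)) % (2 * n), Nat.mod_lt _ hn⟩

variable {n a T m α : ℕ} (hn : 0 < 2 * n)

lemma cmap_add_a (r i : ℕ) (b : Bool) :
    ((cmap n a hn r (i, b)).val + a) % (2 * n) = (cmap n a hn r (i + 1, b)).val := by
  simp only [cmap, Nat.mod_add_mod]
  congr 1; ring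

lemma cmap_add_n (r i : ℕ) (b : Bool) :
    ((cmap n a hn r (i, b)).val + n) % (2 * n) = (cmap n a hn r (i, !b)).val := by
  simp only [cmap, Nat.mod_add_mod]
  cases b
  · simp
  · simp only [if_true, Bool.not_true, Bool.false_eq_true, if_false, add_zero]
    rw [add_assoc, ← two_mul, Nat.add_mod_right]

lemma cmap_wrap (hnT : n = T * m) (haT : a = T * α) (r : ℕ) (b : Bool) :
    cmap n a hn r (m, b) = cmap n a hn r (0, xor b (decide (α % 2 = 1))) := by
  apply Fin.ext
  have e : m * a = α * n := by rw [hnT, haT]; ring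
  simp only [cmap, e, zero_mul, add_zero]
  rcases Nat.even_or_odd' α with ⟨β, rfl | rfl⟩
  · have e2 : r + 2 * β * n + (if b = true then n else 0) = r + (if b = true then n else 0) + (2 * n) * β := by ring
    rw [e2, Nat.add_mul_mod_self_left]
    simp
  · have h1 : (2 * β + 1) % 2 = 1 := by omega
    cases b
    · simp only [h1]
      simp only [Bool.false_eq_true, if_false, decide_true, Bool.xor_true, Bool.not_false, if_true]
      rw [show r + (2 * β + 1) * n + 0 = r + n + (2 * n) * β by ring, Nat.add_mul_mod_self_left]
    · simp only [h1]
      simp only [if_true, decide_true, Bool.xor_true, Bool.not_true, Bool.false_eq_true, if_false]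
      rw [show r + (2 * β + 1) * n + n = r + 0 + (2 * n) * (β + 1) by ring, Nat.add_mul_mod_self_left]

lemma cmap_inj (hT : 0 < T) (hm : 0 < m) (hnT : n = T * m) (haT : a = T * α)
    (hco : Nat.Coprime α m) {r r' i j : ℕ} {b c : Bool} (hr : r < T) (hr' : r' < T)
    (hi : i < m) (hj : j < m) (h : cmap n a hn r (i, b) = cmap n a hn r' (j, c)) :
    r = r' ∧ i = j ∧ b = c := by
  have h : r + i * a + (if b then n else 0) ≡ r' + j * a + (if c then n else 0) [MOD 2 * n] :=
    Fin.ext_iff.1 h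
  have hrr : r = r' := by
    have h1 : r + i * a + (if b then n else 0) ≡ r' + j * a + (if c then n else 0) [MOD T] :=
      h.of_dvd (by rw [hnT]; exact Dvd.intro (2 * m) (by ring))
    have h2 : ∀ (r i : ℕ) (b : Bool), r + i * a + (if b then n else 0) ≡ r [MOD T] := by
      intro r i b
      have : r + i * a + (if b then n else 0) = r + T * (i * α + if b then m else 0) := by
        rw [haT, hnT]; split_ifs <;> ring
      rw [this]
      exact Nat.add_mul_mod_self_left _ _ _
    have h3 : r ≡ r' [MOD T] := (h2 r i b).symm.trans (h1.trans (h2 r' j c))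
    exact h3.eq_of_lt_of_lt hr hr'
  subst hrr
  have h4 : i * α + (if b then m else 0) ≡ j * α + (if c then m else 0) [MOD 2 * m] := by
    rw [add_assoc, add_assoc] at h
    have h := Nat.ModEq.add_left_cancel' r h
    have e : ∀ (i : ℕ) (b : Bool), i * a + (if b then n else 0) = T * (i * α + if b then m else 0) := by
      intro i b; rw [haT, hnT]; split_ifs <;> ring
    rw [e, e, show 2 * n = T * (2 * m) by rw [hnT]; ring] at h
    exact Nat.ModEq.mul_left_cancel' hT.ne' h
  have hij : i = j := by
    have h5 := h4.of_dvd (Dvd.intro_left 2 rfl : m ∣ 2 * m)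
    have h6 : ∀ (i : ℕ) (b : Bool), i * α + (if b then m else 0) ≡ i * α [MOD m] := by
      intro i b
      split_ifs
      · exact Nat.add_modEq_right
      · rfl
    have h7 : i * α ≡ j * α [MOD m] := (h6 i b).symm.trans (h5.trans (h6 j c))
    have h8 : i ≡ j [MOD m] := Nat.ModEq.cancel_right_of_coprime (by rwa [Nat.gcd_comm]) h7
    exact h8.eq_of_lt_of_lt hi hj
  subst hij
  refine ⟨rfl, rfl, ?_⟩
  have h9 := Nat.ModEq.add_left_cancel' _ h4
  have h10 := h9.eq_of_lt_of_lt (by split_ifs <;> omega) (by split_ifs <;> omega)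
  cases b <;> cases c <;> simp at h10 ⊢ <;> omega

/-- The next vertex along the cycle. -/
def nxt (m : ℕ) (τ : Bool) (p : ℕ × Bool) : ℕ × Bool :=
  if p.1 + 1 = m then (0, xor p.2 τ) else (p.1 + 1, p.2)

lemma cmap_nxt (hnT : n = T * m) (haT : a = T * α) (r : ℕ) (p : ℕ × Bool) :
    ((cmap n a hn r p).val + a) % (2 * n) =
      (cmap n a hn r (nxt m (decide (α % 2 = 1)) p)).val := by
  obtain ⟨i, b⟩ := p
  rw [cmap_add_a]
  unfold nxt
  simp only
  split_ifs with h
  · rw [h, cmap_wrap hn hnT haT]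
  · rfl

lemma circ_adj_cmap (ha1 : 1 ≤ a) (han : a < n) (hT : 0 < T) (hm : 2 ≤ m) (hnT : n = T * m)
    (haT : a = T * α) (hco : Nat.Coprime α m) {r r' : ℕ} (hr : r < T) (hr' : r' < T)
    {p q : ℕ × Bool} (hp : p.1 < m) (hq : q.1 < m) :
    (circulantGraph (2 * n) ({a, n} : Set ℕ)).Adj (cmap n a hn r p) (cmap n a hn r' q) ↔
      r = r' ∧ (cyc m (decide (α % 2 = 1))).Adj p q := by
  have hnx : ∀ p : ℕ × Bool, p.1 < m → (nxt m (decide (α % 2 = 1)) p).1 < m := by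
    intro p hp; unfold nxt; split_ifs
    · simp; omega
    · simp; omega
  have inj : ∀ {r r' : ℕ} {p q : ℕ × Bool}, r < T → r' < T → p.1 < m → q.1 < m →
      ((cmap n a hn r p).val = (cmap n a hn r' q).val ↔ r = r' ∧ p = q) := by
    rintro r r' ⟨i, b⟩ ⟨j, c⟩ hr hr' hp hq
    constructor
    · intro h
      obtain ⟨h1, h2, h3⟩ := cmap_inj hn hT (by omega) hnT haT hco hr hr' hp hq (Fin.ext h)
      exact ⟨h1, Prod.ext h2 h3⟩
    · rintro ⟨h1, h2⟩; rw [h1, h2]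
  rw [circ_adj ha1 han, cmap_nxt hn hnT haT, cmap_nxt hn hnT haT, inj hr' hr hq (hnx p hp),
    inj hr hr' hp (hnx q hq)]
  obtain ⟨i, b⟩ := p
  obtain ⟨j, c⟩ := q
  rw [cmap_add_n, inj hr' hr hq (by exact hp)]
  rw [eq_comm (a := r') (b := r), ← and_or_left, ← and_or_left]
  refine and_congr_right fun _ => ?_
  rw [cyc_adj]
  unfold nxt
  generalize decide (α % 2 = 1) = τ
  simp only at hp hq ⊢
  split_ifs <;> cases b <;> cases c <;> cases τ <;> simp <;> omega

/-- Image with the classical instance. -/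
noncomputable def cimg {A B : Type*} (f : A → B) (s : Finset A) : Finset B :=
  @Finset.image _ _ (fun a b => Classical.propDecidable (a = b)) f s

open Classical in
lemma mem_cimg {A B : Type*} {f : A → B} {s : Finset A} {b : B} :
    b ∈ cimg f s ↔ ∃ a ∈ s, f a = b := by
  unfold cimg; exact Finset.mem_image

open Classical in
lemma card_cimg {A B : Type*} {f : A → B} {s : Finset A} (h : Set.InjOn f s) :
    (cimg f s).card = s.card := by
  unfold cimg; exact Finset.card_image_of_injOn h

open Classical in
/-- Main combinatorial statement. -/
lemma circ_isD (ha1 : 1 ≤ a) (han : a < n) (hT : 0 < T) (hm : 2 ≤ m) (hnT : n = T * m)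
    (haT : a = T * α) (hco : Nat.Coprime α m) {D : Finset (Fin (2 * n)) → ℕ → Prop}
    (h : DP (circulantGraph (2 * n) ({a, n} : Set ℕ)) Finset.univ D) (d : ℕ)
    (hd : ∀ D' : Finset (ℕ × Bool) → ℕ → Prop, DP (cyc m (decide (α % 2 = 1))) (cycΩ m) D' →
      IsD D' (cycΩ m) d) : IsD D Finset.univ (T * d) := by
  have hn : 0 < 2 * n := by omega
  have hinj : ∀ {r r' : ℕ} {p q : ℕ × Bool}, r < T → r' < T → p.1 < m → q.1 < m →
      cmap n a hn r p = cmap n a hn r' q → r = r' ∧ p = q := by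
    rintro r r' ⟨i, b⟩ ⟨j, c⟩ hr hr' hp hq h
    obtain ⟨h1, h2, h3⟩ := cmap_inj hn hT (by omega) hnT haT hco hr hr' hp hq h
    exact ⟨h1, Prod.ext h2 h3⟩
  have memΩ : ∀ p : ℕ × Bool, p ∈ cycΩ m ↔ p.1 < m := fun ⟨i, c⟩ => mem_cycΩ m i c
  let comp : ℕ → Finset (Fin (2 * n)) := fun r => cimg (cmap n a hn r) (cycΩ m)
  have hdis : ∀ r < T, ∀ r' < T, r ≠ r' → Disjoint (comp r) (comp r') := by
    intro r hr r' hr' hne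
    rw [Finset.disjoint_left]
    intro x hx hx'
    obtain ⟨p, hp, rfl⟩ := mem_cimg.1 hx
    obtain ⟨q, hq, hpq⟩ := mem_cimg.1 hx'
    exact hne (hinj hr' hr ((memΩ q).1 hq) ((memΩ p).1 hp) hpq).1.symm
  have hun : (Finset.range T).biUnion comp = Finset.univ := by
    apply Finset.eq_univ_of_card
    rw [Finset.card_biUnion]
    · rw [Finset.sum_congr rfl (g := fun _ => m * 2)]
      · simp only [Finset.sum_const, Finset.card_range, smul_eq_mul, Fintype.card_fin, hnT]; ring
      · intro r hr
        rw [Finset.mem_range] at hr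
        show (cimg (cmap n a hn r) (cycΩ m)).card = _
        rw [card_cimg]
        · simp [cycΩ]
        · intro p hp q hq hpq
          exact (hinj hr hr ((memΩ p).1 hp) ((memΩ q).1 hq) hpq).2
    · intro r hr r' hr' hne
      exact hdis r (by simpa using hr) r' (by simpa using hr') hne
  have := h.copies comp T d (fun r hr => Finset.subset_univ _) hdis ?_ ?_ T le_rfl
  · convert this using 1
    rw [← hun]
    ext x; simp only [Finset.mem_biUnion]
  · intro r hr r' hr' hne u hu v hv
    obtain ⟨p, hp, rfl⟩ := mem_cimg.1 hu
    obtain ⟨q, hq, rfl⟩ := mem_cimg.1 hv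
    rw [circ_adj_cmap hn ha1 han hT hm hnT haT hco hr hr' ((memΩ p).1 hp) ((memΩ q).1 hq)]
    exact fun h => hne h.1
  · intro r hr D' hD'
    have := hd _ (hD'.pullback (G' := cyc m (decide (α % 2 = 1))) (Ω' := cycΩ m)
      (cmap n a hn r) ?_ (Finset.Subset.refl _) ?_)
    · exact this
    · intro p hp q hq hpq
      exact (hinj hr hr ((memΩ p).1 hp) ((memΩ q).1 hq) hpq).2
    · intro p hp q hq
      rw [circ_adj_cmap hn ha1 han hT hm hnT haT hco hr hr ((memΩ p).1 hp) ((memΩ q).1 hq)]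
      simp

end circ

/-! ### Vanishing of Ext -/

section extvan

open CategoryTheory CategoryTheory.Abelian

universe u

variable {R : Type u} [CommRing R]

/-- `Ext^i(N, M) = 0` for all `i < n`. -/
def EV (N M : Type u) [AddCommGroup N] [Module R N] [AddCommGroup M] [Module R M] (n : ℕ) : Prop :=
  ∀ i < n, Subsingleton (Ext (ModuleCat.of R N) (ModuleCat.of R M) i)

variable {N A B C : Type u} [AddCommGroup N] [Module R N] [AddCommGroup A] [Module R A]
  [AddCommGroup B] [Module R B] [AddCommGroup C] [Module R C]

/-- The short complex attached to an exact pair. -/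
def sesC (f : A →ₗ[R] B) (g : B →ₗ[R] C) (ex : Function.Exact f g) :
    ShortComplex (ModuleCat.{u} R) :=
  ModuleCat.shortComplexOfCompEqZero f g ex.linearMap_comp_eq_zero

lemma sesC_exact (f : A →ₗ[R] B) (g : B →ₗ[R] C) (ex : Function.Exact f g)
    (hf : Function.Injective f) (hg : Function.Surjective g) : (sesC f g ex).ShortExact where
  exact := ModuleCat.shortComplex_exact _ ex
  mono_f := by rw [ModuleCat.mono_iff_injective]; exact hf
  epi_g := by rw [ModuleCat.epi_iff_surjective]; exact hg

lemma EV.mid {f : A →ₗ[R] B} {g : B →ₗ[R] C} (ex : Function.Exact f g)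
    (hf : Function.Injective f) (hg : Function.Surjective g) {n : ℕ}
    (h1 : EV (R := R) N A n) (h3 : EV (R := R) N C n) : EV (R := R) N B n := by
  intro i hi
  have := h1 i hi
  have := h3 i hi
  refine subsingleton_of_forall_eq 0 fun x => ?_
  obtain ⟨y, hy⟩ := Ext.covariant_sequence_exact₂ (ModuleCat.of R N) (sesC_exact f g ex hf hg) x
    (@Subsingleton.elim _ (h3 i hi) _ _)
  have hy0 : y = 0 := @Subsingleton.elim _ (h1 i hi) y 0
  rw [← hy, hy0, Ext.zero_comp]
  rfl

lemma EV.right {f : A →ₗ[R] B} {g : B →ₗ[R] C} (ex : Function.Exact f g)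
    (hf : Function.Injective f) (hg : Function.Surjective g) {n : ℕ}
    (h1 : EV (R := R) N A (n + 1)) (h2 : EV (R := R) N B n) : EV (R := R) N C n := by
  intro i hi
  refine subsingleton_of_forall_eq 0 fun x => ?_
  obtain ⟨y, hy⟩ := Ext.covariant_sequence_exact₃ (ModuleCat.of R N) (sesC_exact f g ex hf hg) x
    rfl (@Subsingleton.elim _ (h1 (i + 1) (by omega)) _ _)
  have hy0 : y = 0 := @Subsingleton.elim _ (h2 i hi) y 0
  rw [← hy, hy0, Ext.zero_comp]
  rfl

lemma EV.left_aux {f : A →ₗ[R] B} {g : B →ₗ[R] C} (ex : Function.Exact f g)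
    (hf : Function.Injective f) (hg : Function.Surjective g) {n : ℕ}
    (h3 : EV (R := R) N C n) (i : ℕ) (hi : i < n + 1)
    (x : Ext (ModuleCat.of R N) (ModuleCat.of R A) i)
    (hx : x.comp (Ext.mk₀ (ModuleCat.ofHom f)) (add_zero i) = 0) : x = 0 := by
  cases i with
  | zero =>
    have : Mono (ModuleCat.ofHom f) := by rw [ModuleCat.mono_iff_injective]; exact hf
    apply Ext.postcomp_mk₀_injective_of_mono (ModuleCat.of R N) (ModuleCat.ofHom f)
    simpa using hx
  | succ j =>
    obtain ⟨y, hy⟩ := Ext.covariant_sequence_exact₁ (ModuleCat.of R N) (sesC_exact f g ex hf hg) x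
      hx rfl
    have hy0 : y = 0 := @Subsingleton.elim _ (h3 j (by omega)) y 0
    rw [← hy, hy0, Ext.zero_comp]
    rfl

lemma EV.left {f : A →ₗ[R] B} {g : B →ₗ[R] C} (ex : Function.Exact f g)
    (hf : Function.Injective f) (hg : Function.Surjective g) {n : ℕ}
    (h2 : EV (R := R) N B (n + 1)) (h3 : EV (R := R) N C n) : EV (R := R) N A (n + 1) := by
  intro i hi
  refine subsingleton_of_forall_eq 0 fun x => ?_
  exact EV.left_aux ex hf hg h3 i hi x (@Subsingleton.elim _ (h2 i hi) _ _)

lemma EV.smul {r : R} {g : A →ₗ[R] C} (hr : ∀ x : N, r • x = 0)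
    (ex : Function.Exact (LinearMap.lsmul R A r) g)
    (hf : Function.Injective (LinearMap.lsmul R A r)) (hg : Function.Surjective g) {n : ℕ}
    (h3 : EV (R := R) N C n) : EV (R := R) N A (n + 1) := by
  intro i hi
  refine subsingleton_of_forall_eq 0 fun x => ?_
  refine EV.left_aux ex hf hg h3 i hi x ?_
  have h := Ext.postcomp_smul_id_eq_zero_of_mem_annihilator (M := ModuleCat.of R A)
    (N := ModuleCat.of R N) (r := r) (Module.mem_annihilator.2 hr) i
  have h' := congrArg (fun f => f.hom x) h
  exact h'

lemma EV.retract (i : A →ₗ[R] B) (p : B →ₗ[R] A) (hpi : p ∘ₗ i = LinearMap.id) {n : ℕ}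
    (h : EV (R := R) N B n) : EV (R := R) N A n := by
  intro j hj
  refine subsingleton_of_forall_eq 0 fun x => ?_
  have e : ModuleCat.ofHom i ≫ ModuleCat.ofHom p = 𝟙 (ModuleCat.of R A) := by
    rw [← ModuleCat.ofHom_comp, hpi]; rfl
  have : (x.comp (Ext.mk₀ (ModuleCat.ofHom i)) (add_zero j)).comp (Ext.mk₀ (ModuleCat.ofHom p))
      (add_zero j) = x := by
    rw [Ext.comp_assoc_of_second_deg_zero, Ext.mk₀_comp_mk₀, e, Ext.comp_mk₀_id]
  rw [← this, @Subsingleton.elim _ (h j hj) (x.comp (Ext.mk₀ (ModuleCat.ofHom i)) (add_zero j)) 0,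
    Ext.zero_comp]

lemma EV.fst {n : ℕ} (h : EV (R := R) N (A × B) n) : EV (R := R) N A n :=
  EV.retract (LinearMap.inl R A B) (LinearMap.fst R A B) (by ext; simp) h

lemma EV.prod {n : ℕ} (h : EV (R := R) N A n) (h' : EV (R := R) N B n) :
    EV (R := R) N (A × B) n :=
  EV.mid (f := LinearMap.inl R A B) (g := LinearMap.snd R A B) Function.Exact.inl_snd
    LinearMap.inl_injective LinearMap.snd_surjective h h'

lemma EV.not_self [Nontrivial N] : ¬ EV (R := R) N N 1 := by
  intro h
  have h0 := h 0 one_pos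
  have : Subsingleton (ModuleCat.of R N ⟶ ModuleCat.of R N) :=
    Ext.addEquiv₀.subsingleton_congr.mp h0
  have : Subsingleton (N →ₗ[R] N) := 
    (ModuleCat.homAddEquiv (M := ModuleCat.of R N) (N := ModuleCat.of R N)).symm.toEquiv.subsingleton
  obtain ⟨x, hx⟩ := exists_ne (0 : N)
  exact hx (congrArg (fun f : N →ₗ[R] N => f x) (Subsingleton.elim LinearMap.id 0))

/-- The Mayer-Vietoris maps for two ideals. -/
def mvF (I J : Ideal R) : (R ⧸ (I ⊓ J)) →ₗ[R] (R ⧸ I) × (R ⧸ J) :=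
  (Submodule.factor (inf_le_left : I ⊓ J ≤ I)).prod (Submodule.factor (inf_le_right : I ⊓ J ≤ J))

/-- The Mayer-Vietoris maps for two ideals. -/
def mvG (I J : Ideal R) : (R ⧸ I) × (R ⧸ J) →ₗ[R] R ⧸ (I ⊔ J) :=
  (Submodule.factor (le_sup_left : I ≤ I ⊔ J)) ∘ₗ LinearMap.fst R _ _ -
    (Submodule.factor (le_sup_right : J ≤ I ⊔ J)) ∘ₗ LinearMap.snd R _ _

lemma mvF_inj (I J : Ideal R) : Function.Injective (mvF I J) := by
  rw [injective_iff_map_eq_zero]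
  intro x hx
  obtain ⟨x, rfl⟩ := Submodule.Quotient.mk_surjective _ x
  have h1 := congrArg Prod.fst hx
  have h2 := congrArg Prod.snd hx
  rw [Submodule.Quotient.mk_eq_zero]
  exact ⟨(Submodule.Quotient.mk_eq_zero _).1 h1, (Submodule.Quotient.mk_eq_zero _).1 h2⟩

lemma mvG_surj (I J : Ideal R) : Function.Surjective (mvG I J) := by
  intro x
  obtain ⟨x, rfl⟩ := Submodule.Quotient.mk_surjective _ x
  refine ⟨(Submodule.Quotient.mk x, 0), ?_⟩
  simp [mvG]

lemma mv_exact (I J : Ideal R) : Function.Exact (mvF I J) (mvG I J) := by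
  rintro ⟨x, y⟩
  obtain ⟨x, rfl⟩ := Submodule.Quotient.mk_surjective _ x
  obtain ⟨y, rfl⟩ := Submodule.Quotient.mk_surjective _ y
  constructor
  · intro h
    have h' : (Submodule.Quotient.mk x : R ⧸ (I ⊔ J)) - Submodule.Quotient.mk y = 0 := h
    rw [← Submodule.Quotient.mk_sub, Submodule.Quotient.mk_eq_zero] at h'
    obtain ⟨i, hi, j, hj, hij⟩ := Submodule.mem_sup.1 h'
    refine ⟨Submodule.Quotient.mk (x - i), Prod.ext ?_ ?_⟩
    · show (Submodule.Quotient.mk (x - i) : R ⧸ I) = Submodule.Quotient.mk x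
      rw [Submodule.Quotient.eq]; simpa using hi
    · show (Submodule.Quotient.mk (x - i) : R ⧸ J) = Submodule.Quotient.mk y
      rw [Submodule.Quotient.eq]
      have : x - i - y = j := by rw [sub_right_comm, ← hij]; ring
      rwa [this]
  · rintro ⟨z, hz⟩
    obtain ⟨z, rfl⟩ := Submodule.Quotient.mk_surjective _ z
    rw [← hz]
    show (Submodule.Quotient.mk z : R ⧸ (I ⊔ J)) - Submodule.Quotient.mk z = 0
    simp

end extvan

/-! ### The monomial ideals attached to vertex subsets -/

section monid

universe u

variable {K : Type u} [Field K] {V : Type} (G : SimpleGraph V)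

/-- Monomials surviving in the quotient attached to `U`. -/
def Good (U : Finset V) (m : V →₀ ℕ) : Prop :=
  m.support ⊆ U ∧ ∀ i ∈ m.support, ∀ j ∈ m.support, ¬ G.Adj i j

variable {G}

lemma Good.mono {U : Finset V} {m m' : V →₀ ℕ} (h : Good G U m) (hm : m'.support ⊆ m.support) :
    Good G U m' :=
  ⟨hm.trans h.1, fun i hi j hj => h.2 i (hm hi) j (hm hj)⟩

variable (K G) in
/-- The monomial ideal attached to `U`. -/
def JU (U : Finset V) : Ideal (MvPolynomial V K) where
  carrier := {f | ∀ m ∈ f.support, ¬ Good G U m}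
  zero_mem' := by simp
  add_mem' := by
    classical
    intro f g hf hg m hm
    rcases Finset.mem_union.1 (MvPolynomial.support_add hm) with h | h
    · exact hf m h
    · exact hg m h
  smul_mem' := by
    classical
    intro c f hf m hm hgood
    obtain ⟨m1, _, m2, h2, rfl⟩ := Finset.mem_add.1 (MvPolynomial.support_mul c f hm)
    refine hf m2 h2 (hgood.mono ?_)
    exact Finsupp.support_mono (self_le_add_left m2 m1)

lemma mem_JU {U : Finset V} {f : MvPolynomial V K} :
    f ∈ JU K G U ↔ ∀ m ∈ f.support, ¬ Good G U m := Iff.rfl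

lemma monomial_mem_JU {U : Finset V} {m : V →₀ ℕ} (h : ¬ Good G U m) (c : K) :
    monomial m c ∈ JU K G U := by
  intro m' hm'
  rw [Finset.mem_singleton.1 (MvPolynomial.support_monomial_subset hm')]
  exact h

lemma JU_le {U : Finset V} {I : Ideal (MvPolynomial V K)}
    (h : ∀ m, ¬ Good G U m → ∀ c, monomial m c ∈ I) : JU K G U ≤ I := by
  intro f hf
  rw [f.as_sum]
  exact Ideal.sum_mem _ fun m hm => h m (hf m hm) _

lemma JU_anti {U U' : Finset V} (h : U' ⊆ U) : JU K G U ≤ JU K G U' :=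
  fun _ hf m hm hg => hf m hm ⟨hg.1.trans h, hg.2⟩

lemma JU_empty : JU K G (∅ : Finset V) = maxIdeal K V := by
  apply le_antisymm
  · apply JU_le
    intro m hm c
    have : ∃ v, m v ≠ 0 := by
      by_contra hc
      push Not at hc
      apply hm
      have : m = 0 := by ext v; simpa using hc v
      subst this
      simp [Good]
    obtain ⟨v, hv⟩ := this
    have e : monomial m c = monomial (m - Finsupp.single v 1) c * X v := by
      rw [X, monomial_mul, mul_one, tsub_add_cancel_of_le]
      rw [Finsupp.single_le_iff]; omega
    rw [e]
    exact Ideal.mul_mem_left _ _ (Ideal.subset_span ⟨v, rfl⟩)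
  · rw [maxIdeal, Ideal.span_le]
    rintro _ ⟨v, rfl⟩
    apply monomial_mem_JU
    intro h
    have := h.1 (show v ∈ _ by simp)
    simp at this

lemma JU_univ [Fintype V] : JU K G (Finset.univ : Finset V) = edgeIdeal K G := by
  classical
  apply le_antisymm
  · apply JU_le
    intro m hm c
    have : ∃ i ∈ m.support, ∃ j ∈ m.support, G.Adj i j := by
      by_contra hc
      push Not at hc
      exact hm ⟨Finset.subset_univ _, hc⟩
    obtain ⟨i, hi, j, hj, hij⟩ := this
    rw [Finsupp.mem_support_iff] at hi hj
    have e : monomial m c = monomial (m - (Finsupp.single i 1 + Finsupp.single j 1)) c *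
        (X i * X j) := by
      rw [X, X, monomial_mul, monomial_mul, mul_one, mul_one, tsub_add_cancel_of_le]
      intro k
      have hne := hij.ne
      simp only [Finsupp.add_apply, Finsupp.single_apply]
      split_ifs with h1 h2 h2
      · exact absurd (h1.trans h2.symm) hne
      · subst h1; omega
      · subst h2; omega
      · omega
    rw [e]
    exact Ideal.mul_mem_left _ _ (Ideal.subset_span ⟨i, j, hij, rfl⟩)
  · rw [edgeIdeal, Ideal.span_le]
    rintro _ ⟨i, j, hij, rfl⟩
    rw [X, X, monomial_mul]
    apply monomial_mem_JU
    intro h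
    exact h.2 i (by simp) j (by simp) hij

open Classical in
lemma JU_inf {U P Q : Finset V} (hPQ : ∀ p ∈ P, ∀ q ∈ Q, G.Adj p q) :
    JU K G (U \ P) ⊓ JU K G (U \ Q) = JU K G U := by
  apply le_antisymm
  · rintro f ⟨h1, h2⟩ m hm hg
    have a1 := h1 m hm
    have a2 := h2 m hm
    have b1 : ∃ p ∈ m.support, p ∈ P := by
      by_contra hc
      push Not at hc
      exact a1 ⟨fun x hx => Finset.mem_sdiff.2 ⟨hg.1 hx, hc x hx⟩, hg.2⟩
    have b2 : ∃ p ∈ m.support, p ∈ Q := by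
      by_contra hc
      push Not at hc
      exact a2 ⟨fun x hx => Finset.mem_sdiff.2 ⟨hg.1 hx, hc x hx⟩, hg.2⟩
    obtain ⟨p, hp, hpP⟩ := b1
    obtain ⟨q, hq, hqQ⟩ := b2
    exact hg.2 p hp q hq (hPQ p hpP q hqQ)
  · exact le_inf (JU_anti Finset.sdiff_subset) (JU_anti Finset.sdiff_subset)

open Classical in
lemma JU_sup {U P Q : Finset V} :
    JU K G (U \ P) ⊔ JU K G (U \ Q) = JU K G (U \ (P ∪ Q)) := by
  apply le_antisymm
  · apply sup_le
    · exact JU_anti (Finset.sdiff_subset_sdiff subset_rfl Finset.subset_union_left)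
    · exact JU_anti (Finset.sdiff_subset_sdiff subset_rfl Finset.subset_union_right)
  · apply JU_le
    intro m hm c
    by_cases h1 : Good G (U \ P) m
    · by_cases h2 : Good G (U \ Q) m
      · exfalso
        apply hm
        refine ⟨fun x hx => ?_, h1.2⟩
        have a1 := Finset.mem_sdiff.1 (h1.1 hx)
        have a2 := Finset.mem_sdiff.1 (h2.1 hx)
        simp [a1, a2]
      · exact Ideal.mem_sup_right (monomial_mem_JU h2 c)
    · exact Ideal.mem_sup_left (monomial_mem_JU h1 c)

lemma good_add {U : Finset V} {v : V} (hv : v ∈ U) (hi : ∀ w ∈ U, ¬ G.Adj v w) {m : V →₀ ℕ}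
    (h : Good G U m) : Good G U (m + Finsupp.single v 1) := by
  classical
  have hs : ∀ i ∈ (m + Finsupp.single v 1).support, i ∈ m.support ∨ i = v := by
    intro i hi'
    rcases Finset.mem_union.1 (Finsupp.support_add hi') with h | h
    · exact Or.inl h
    · exact Or.inr (Finset.mem_singleton.1 (Finsupp.support_single_subset h))
  refine ⟨fun i hi' => ?_, fun i hi' j hj' hij => ?_⟩
  · rcases hs i hi' with h' | rfl
    · exact h.1 h'
    · exact hv
  · rcases hs i hi' with h1 | rfl
    · rcases hs j hj' with h2 | rfl
      · exact h.2 i h1 j h2 hij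
      · exact hi i (h.1 h1) hij.symm
    · rcases hs j hj' with h2 | rfl
      · exact hi j (h.1 h2) hij
      · exact G.irrefl hij

lemma JU_X_mul {U : Finset V} {v : V} (hv : v ∈ U) (hi : ∀ w ∈ U, ¬ G.Adj v w)
    {f : MvPolynomial V K} (h : X v * f ∈ JU K G U) : f ∈ JU K G U := by
  intro m hm hg
  refine h (m + Finsupp.single v 1) ?_ (good_add hv hi hg)
  rw [mul_comm, MvPolynomial.mem_support_iff, coeff_mul_X]
  exact MvPolynomial.mem_support_iff.1 hm

open Classical in
lemma JU_erase_le {U : Finset V} {v : V} :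
    JU K G (U.erase v) ≤ JU K G U ⊔ Ideal.span {X v} := by
  apply JU_le
  intro m hm c
  by_cases h1 : Good G U m
  · have hmv : m v ≠ 0 := by
      intro h0
      apply hm
      refine ⟨fun x hx => Finset.mem_erase.2 ⟨?_, h1.1 hx⟩, h1.2⟩
      rintro rfl
      exact Finsupp.mem_support_iff.1 hx h0
    apply Ideal.mem_sup_right
    have e : monomial m c = monomial (m - Finsupp.single v 1) c * X v := by
      rw [X, monomial_mul, mul_one, tsub_add_cancel_of_le]
      rw [Finsupp.single_le_iff]; omega
    rw [e]
    exact Ideal.mul_mem_left _ _ (Ideal.subset_span rfl)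
  · exact Ideal.mem_sup_left (monomial_mem_JU h1 c)

open Classical in
lemma X_mem_JU_erase {U : Finset V} {v : V} : (X v : MvPolynomial V K) ∈ JU K G (U.erase v) := by
  apply monomial_mem_JU
  intro h
  have := h.1 (show v ∈ _ by simp)
  simp at this

variable (K G) in
/-- The depth predicate. -/
def DE (U : Finset V) (n : ℕ) : Prop :=
  EV (R := MvPolynomial V K) (MvPolynomial V K ⧸ JU K G (∅ : Finset V))
    (MvPolynomial V K ⧸ JU K G U) n

lemma maxIdeal_ne_top : JU K G (∅ : Finset V) ≠ ⊤ := by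
  rw [Ne, Ideal.eq_top_iff_one]
  intro h
  refine h 0 (by simp) ?_
  simp [Good]

open Classical in
lemma DE_iso {U : Finset V} {v : V} (hv : v ∈ U) (hi : ∀ w ∈ U, ¬ G.Adj v w) (n : ℕ) :
    DE K G U (n + 1) ↔ DE K G (U.erase v) n := by
  let f := LinearMap.lsmul (MvPolynomial V K) (MvPolynomial V K ⧸ JU K G U) (X v)
  let g : (MvPolynomial V K ⧸ JU K G U) →ₗ[MvPolynomial V K]
    (MvPolynomial V K ⧸ JU K G (U.erase v)) := Submodule.factor (JU_anti (Finset.erase_subset v U))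
  have hf : Function.Injective f := by
    rw [injective_iff_map_eq_zero]
    intro x hx
    obtain ⟨x, rfl⟩ := Submodule.Quotient.mk_surjective _ x
    rw [Submodule.Quotient.mk_eq_zero]
    have hx' : (Submodule.Quotient.mk (X v * x) : MvPolynomial V K ⧸ JU K G U) = 0 := hx
    rw [Submodule.Quotient.mk_eq_zero] at hx'
    exact JU_X_mul hv hi hx'
  have hg : Function.Surjective g := Submodule.factor_surjective _
  have ex : Function.Exact f g := by
    intro y
    obtain ⟨y, rfl⟩ := Submodule.Quotient.mk_surjective _ y
    constructor
    · intro h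
      have h' : (Submodule.Quotient.mk y : MvPolynomial V K ⧸ JU K G (U.erase v)) = 0 := h
      rw [Submodule.Quotient.mk_eq_zero] at h'
      obtain ⟨p, hp, q, hq, hpq⟩ := Submodule.mem_sup.1 (JU_erase_le h')
      obtain ⟨z, rfl⟩ := Ideal.mem_span_singleton'.1 hq
      refine ⟨Submodule.Quotient.mk z, ?_⟩
      show (Submodule.Quotient.mk (X v * z) : MvPolynomial V K ⧸ JU K G U) = _
      rw [Submodule.Quotient.eq]
      have : X v * z - y = -p := by rw [← hpq]; ring
      rw [this]
      exact neg_mem hp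
    · rintro ⟨z, hz⟩
      obtain ⟨z, rfl⟩ := Submodule.Quotient.mk_surjective _ z
      rw [← hz]
      show (Submodule.Quotient.mk (X v * z) : MvPolynomial V K ⧸ JU K G (U.erase v)) = 0
      rw [Submodule.Quotient.mk_eq_zero]
      exact Ideal.mul_mem_right _ _ X_mem_JU_erase
  constructor
  · intro h
    exact EV.right ex hf hg h fun i hi => h i (by omega)
  · intro h
    refine EV.smul ?_ ex hf hg h
    intro x
    obtain ⟨x, rfl⟩ := Submodule.Quotient.mk_surjective _ x
    show (Submodule.Quotient.mk (X v * x) : MvPolynomial V K ⧸ JU K G ∅) = 0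
    rw [Submodule.Quotient.mk_eq_zero]
    apply Ideal.mul_mem_right
    exact monomial_mem_JU (fun h => by
      have := h.1 (show v ∈ _ by simp)
      simp at this) 1

/-- The three rules from the Mayer-Vietoris sequence. -/
lemma EV_mv {R : Type u} [CommRing R] {N : Type u} [AddCommGroup N] [Module R N]
    {I J A B : Ideal R} (hA : I ⊓ J = A) (hB : I ⊔ J = B) (n : ℕ) :
    (EV (R := R) N (R ⧸ I) (n + 1) → EV (R := R) N (R ⧸ J) (n + 1) → EV (R := R) N (R ⧸ B) n →
      EV (R := R) N (R ⧸ A) (n + 1)) ∧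
    (EV (R := R) N (R ⧸ I) (n + 1) → EV (R := R) N (R ⧸ J) (n + 1) →
      EV (R := R) N (R ⧸ A) (n + 2) → EV (R := R) N (R ⧸ B) (n + 1)) ∧
    (EV (R := R) N (R ⧸ A) (n + 1) → EV (R := R) N (R ⧸ B) (n + 1) →
      EV (R := R) N (R ⧸ I) (n + 1)) := by
  subst hA hB
  refine ⟨fun h1 h2 h3 => ?_, fun h1 h2 h3 => ?_, fun h1 h3 => ?_⟩
  · exact EV.left (mv_exact I J) (mvF_inj I J) (mvG_surj I J) (h1.prod h2) h3
  · exact EV.right (mv_exact I J) (mvF_inj I J) (mvG_surj I J) h3 (h1.prod h2)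
  · exact (EV.mid (mv_exact I J) (mvF_inj I J) (mvG_surj I J) h1 h3).fst

lemma DE_DP [Fintype V] : DP G Finset.univ (DE K G) where
  zero _ _ i hi := by omega
  mono _ _ n h i hi := h i (by omega)
  empty := by
    have : Nontrivial (MvPolynomial V K ⧸ JU K G (∅ : Finset V)) :=
      Ideal.Quotient.nontrivial_iff.2 maxIdeal_ne_top
    exact EV.not_self
  iso U _ v hv hi n := DE_iso hv hi n
  lower U _ P Q hPQ n := (EV_mv (JU_inf hPQ) JU_sup n).1
  up1 U _ P Q hPQ n := (EV_mv (JU_inf hPQ) JU_sup n).2.1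
  up2 U _ P Q hPQ n := (EV_mv (JU_inf hPQ) JU_sup n).2.2

lemma depth_of_isD [Fintype V] {d : ℕ} (h : IsD (DE K G) Finset.univ d) :
    depthQuot (edgeIdeal K G) = d := by
  have hle : JU K G (Finset.univ : Finset V) ≤ JU K G ∅ := JU_anti (Finset.empty_subset _)
  have hlt : JU K G (∅ : Finset V) •
      (⊤ : Submodule (MvPolynomial V K) (MvPolynomial V K ⧸ JU K G (Finset.univ : Finset V))) < ⊤ := by
    rw [lt_top_iff_ne_top]
    intro htop
    have h1 : (Submodule.Quotient.mk 1 : MvPolynomial V K ⧸ JU K G (Finset.univ : Finset V)) ∈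
        JU K G (∅ : Finset V) • (⊤ : Submodule (MvPolynomial V K)
          (MvPolynomial V K ⧸ JU K G (Finset.univ : Finset V))) := by rw [htop]; trivial
    have h2 : ∀ x ∈ JU K G (∅ : Finset V) • (⊤ : Submodule (MvPolynomial V K)
          (MvPolynomial V K ⧸ JU K G (Finset.univ : Finset V))), Submodule.factor hle x = 0 := by
      intro x hx
      refine Submodule.smul_induction_on hx ?_ ?_
      · intro r hr y _
        obtain ⟨y, rfl⟩ := Submodule.Quotient.mk_surjective _ y
        show (Submodule.Quotient.mk (r * y) : MvPolynomial V K ⧸ JU K G ∅) = 0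
        rw [Submodule.Quotient.mk_eq_zero]
        exact Ideal.mul_mem_right _ _ hr
      · intro x y hx hy
        rw [map_add, hx, hy, add_zero]
    have h3 : (Submodule.Quotient.mk 1 : MvPolynomial V K ⧸ JU K G ∅) = 0 := h2 _ h1
    rw [Submodule.Quotient.mk_eq_zero] at h3
    exact maxIdeal_ne_top ((Ideal.eq_top_iff_one _).2 h3)
  have supp : Module.support (MvPolynomial V K) (MvPolynomial V K ⧸ JU K G (∅ : Finset V)) =
      PrimeSpectrum.zeroLocus (JU K G (∅ : Finset V)) := by
    rw [Module.support_eq_zeroLocus, Ideal.annihilator_quotient]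
  have key : ∀ n, (∃ rs : List (MvPolynomial V K), rs.length = n ∧
      (∀ r ∈ rs, r ∈ maxIdeal K V) ∧
      RingTheory.Sequence.IsRegular (MvPolynomial V K ⧸ edgeIdeal K G) rs) ↔
      DE K G Finset.univ n := by
    intro n
    rw [← JU_univ, ← JU_empty (G := G)]
    constructor
    · rintro ⟨rs, rfl, hm, hr⟩
      exact ModuleCat.subsingleton_ext_of_exists_isRegular (JU K G (∅ : Finset V))
        (ModuleCat.of _ (MvPolynomial V K ⧸ JU K G (∅ : Finset V))) supp.subset
        (ModuleCat.of _ (MvPolynomial V K ⧸ JU K G (Finset.univ : Finset V))) hlt rs hm hr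
    · intro hD
      exact ModuleCat.exists_isRegular_of_exists_subsingleton_ext (JU K G (∅ : Finset V)) n
        (ModuleCat.of _ (MvPolynomial V K ⧸ JU K G (Finset.univ : Finset V))) hlt
        (ModuleCat.of _ (MvPolynomial V K ⧸ JU K G (∅ : Finset V))) supp hD
  have hset : {n : ℕ | ∃ rs : List (MvPolynomial V K), rs.length = n ∧
      (∀ r ∈ rs, r ∈ maxIdeal K V) ∧
      RingTheory.Sequence.IsRegular (MvPolynomial V K ⧸ edgeIdeal K G) rs} = Set.Iic d := by
    ext n
    rw [Set.mem_ofPred_eq, key, Set.mem_Iic]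
    constructor
    · intro hn
      by_contra hc
      exact h.2 fun i hi => hn i (by omega)
    · intro hn i hi
      exact h.1 i (by omega)
  rw [depthQuot, hset, csSup_Iic]

end monid

/-! ### Final assembly -/

lemma ceil_aux {x : ℚ} {k : ℕ} (h1 : x ≤ k) (h2 : (k : ℚ) < x + 1) : ⌈x⌉₊ = k := by
  rcases Nat.eq_zero_or_pos k with rfl | hk
  · simpa using h1
  · rw [Nat.ceil_eq_iff hk.ne']
    refine ⟨?_, h1⟩
    rw [Nat.cast_sub hk]; push_cast; linarith

lemma depth_core (n a T m α : ℕ) (ha1 : 1 ≤ a) (han : a < n) (hT : 0 < T) (hm : 2 ≤ m)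
    (hnT : n = T * m) (haT : a = T * α) (hco : Nat.Coprime α m) (K : Type*) [Field K] :
    (α % 2 = 1 → depthQuot (edgeIdeal K (circulantGraph (2 * n) ({a, n} : Set ℕ))) =
      T * (if m % 4 = 1 then (m + 1) / 2 else m / 2)) ∧
    (α % 2 = 0 → depthQuot (edgeIdeal K (circulantGraph (2 * n) ({a, n} : Set ℕ))) =
      T * (if m % 4 = 1 then (m - 1) / 2 else (m + 1) / 2)) := by
  constructor
  · intro hα
    refine depth_of_isD (circ_isD ha1 han hT hm hnT haT hco DE_DP _ fun D' hD' => ?_)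
    rw [decide_eq_true hα] at hD'
    exact cyc_moebius hm hD'
  · intro hα
    have hmo : m % 2 = 1 := by
      by_contra hc
      have : 2 ∣ Nat.gcd α m := Nat.dvd_gcd (by omega) (by omega)
      rw [hco] at this
      omega
    refine depth_of_isD (circ_isD ha1 han hT hm hnT haT hco DE_DP _ fun D' hD' => ?_)
    rw [decide_eq_false (by omega)] at hD'
    exact cyc_prism (by omega) hmo hD'

theorem depth_cubic_circulant (n a t : ℕ) (hn : 2 ≤ n) (ha1 : 1 ≤ a) (han : a < n)
    (ht : t = Nat.gcd (2 * n) a) (K : Type*) [Field K] :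
    (Even (2 * n / t) →
      ((n / t) % 4 = 1 → depthQuot (edgeIdeal K (circulantGraph (2 * n) ({a, n} : Set ℕ))) = ⌈(n : ℚ) / (2 * (t : ℚ))⌉₊ * t) ∧
      ((n / t) % 4 ≠ 1 → depthQuot (edgeIdeal K (circulantGraph (2 * n) ({a, n} : Set ℕ))) = ⌈((n : ℚ) - (t : ℚ)) / (2 * (t : ℚ))⌉₊ * t)) ∧
    (¬ Even (2 * n / t) →
      ((2 * n / t) % 4 = 1 → depthQuot (edgeIdeal K (circulantGraph (2 * n) ({a, n} : Set ℕ))) = ⌈(2 * (n : ℚ) - (t : ℚ)) / (2 * (t : ℚ))⌉₊ * (t / 2)) ∧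
      ((2 * n / t) % 4 = 3 → depthQuot (edgeIdeal K (circulantGraph (2 * n) ({a, n} : Set ℕ))) = ⌈(n : ℚ) / (t : ℚ)⌉₊ * (t / 2))) := by
  obtain ⟨T, hTdef⟩ : ∃ T, T = Nat.gcd n a := ⟨_, rfl⟩
  have hT : 0 < T := by rw [hTdef]; exact Nat.gcd_pos_of_pos_left _ (by omega)
  obtain ⟨m, hnT⟩ : T ∣ n := hTdef ▸ Nat.gcd_dvd_left n a
  obtain ⟨α, haT⟩ : T ∣ a := hTdef ▸ Nat.gcd_dvd_right n a
  have hco' : Nat.gcd m α = 1 := by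
    have h1 : T * Nat.gcd m α = T * 1 := by
      rw [← Nat.gcd_mul_left, ← hnT, ← haT, ← hTdef, mul_one]
    exact Nat.eq_of_mul_eq_mul_left hT h1
  have hco : Nat.Coprime α m := by rw [Nat.coprime_comm]; exact hco'
  have hαm : α < m := by
    rw [hnT, haT] at han; exact Nat.lt_of_mul_lt_mul_left han
  have hα1 : 1 ≤ α := by
    rcases Nat.eq_zero_or_pos α with h | h
    · rw [h] at haT; omega
    · exact h
  have hm : 2 ≤ m := by omega
  obtain ⟨hA, hB⟩ := depth_core n a T m α ha1 han hT hm hnT haT hco K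
  have htT : t = T * Nat.gcd (2 * m) α := by
    rw [ht, ← Nat.gcd_mul_left, ← haT, hnT]; congr 1; ring
  have hTq : (0 : ℚ) < T := by exact_mod_cast hT
  rcases Nat.mod_two_eq_zero_or_one α with hα | hα
  · -- prism case
    have hmo : m % 2 = 1 := by
      by_contra hc
      have : 2 ∣ Nat.gcd m α := Nat.dvd_gcd (by omega) (by omega)
      rw [hco'] at this
      omega
    have hg : Nat.gcd (2 * m) α = 2 := by
      have h1 : Nat.gcd (2 * m) α = Nat.gcd 2 α :=
        Nat.Coprime.gcd_mul_right_cancel 2 hco'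
      rw [h1, Nat.gcd_eq_left (by omega)]
    rw [hg] at htT
    have e1 : 2 * n / t = m := by
      rw [htT, hnT, show 2 * (T * m) = (T * 2) * m by ring, Nat.mul_div_cancel_left _ (by omega)]
    have e2 : t / 2 = T := by rw [htT]; omega
    have hnq : (n : ℚ) = T * m := by rw [hnT]; push_cast; ring
    have htq : (t : ℚ) = T * 2 := by rw [htT]; push_cast; ring
    rw [e1, e2, hB hα, hnq, htq]
    refine ⟨fun h => ?_, fun _ => ⟨fun h4 => ?_, fun h4 => ?_⟩⟩
    · rw [Nat.even_iff] at h; omega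
    · rw [if_pos h4, mul_comm]
      congr 1
      symm
      obtain ⟨k, rfl⟩ : ∃ k, m = 2 * k + 1 := ⟨m / 2, by omega⟩
      have : (2 * ((T : ℚ) * ((2 * k + 1 : ℕ) : ℚ)) - T * 2) / (2 * (T * 2)) = k := by
        push_cast; field_simp; ring
      rw [this, show (2 * k + 1 - 1) / 2 = k by omega]
      simp
    · rw [if_neg (by omega), mul_comm]
      congr 1
      symm
      obtain ⟨k, rfl⟩ : ∃ k, m = 2 * k + 1 := ⟨m / 2, by omega⟩
      have : ((T : ℚ) * ((2 * k + 1 : ℕ) : ℚ)) / (T * 2) = k + 1 / 2 := by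
        push_cast; field_simp
      rw [this, show (2 * k + 1 + 1) / 2 = k + 1 by omega]
      apply ceil_aux <;> push_cast <;> linarith
  · -- Moebius case
    have hg : Nat.gcd (2 * m) α = 1 := by
      have h1 : Nat.gcd (2 * m) α = Nat.gcd 2 α :=
        Nat.Coprime.gcd_mul_right_cancel 2 hco'
      rw [h1, Nat.gcd_rec, hα]; simp
    rw [hg, mul_one] at htT
    have e1 : 2 * n / t = 2 * m := by
      rw [htT, hnT, show 2 * (T * m) = T * (2 * m) by ring, Nat.mul_div_cancel_left _ hT]
    have e2 : n / t = m := by rw [htT, hnT, Nat.mul_div_cancel_left _ hT]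
    have hnq : (n : ℚ) = T * m := by rw [hnT]; push_cast; ring
    rw [e1, e2, hA hα, hnq, htT]
    refine ⟨fun _ => ⟨fun h4 => ?_, fun h4 => ?_⟩, fun h => absurd (even_two_mul m) h⟩
    · rw [if_pos h4, mul_comm]
      congr 1
      symm
      obtain ⟨k, rfl⟩ : ∃ k, m = 2 * k + 1 := ⟨m / 2, by omega⟩
      have : ((T : ℚ) * ((2 * k + 1 : ℕ) : ℚ)) / (2 * T) = k + 1 / 2 := by
        push_cast; field_simp
      rw [this, show (2 * k + 1 + 1) / 2 = k + 1 by omega]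
      apply ceil_aux <;> push_cast <;> linarith
    · rw [if_neg h4, mul_comm]
      congr 1
      symm
      have : ((T : ℚ) * (m : ℚ) - T) / (2 * T) = ((m : ℚ) - 1) / 2 := by
        field_simp
      rw [this]
      have hk1 : ((2 * (m / 2) : ℕ) : ℚ) ≤ m := by exact_mod_cast (by omega)
      have hk2 : (m : ℚ) ≤ ((2 * (m / 2) + 1 : ℕ) : ℚ) := by exact_mod_cast (by omega)
      push_cast at hk1 hk2
      apply ceil_aux <;> linarith
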